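/- arXiv:2111.10568 — 6 statements merged into one kernel-verified Lean document; each statement's English description precedes it below -/
import Mathlib

section
/- For every integer g ≥ 3, the number of balanced trees is |T_g^b| = (g−2)!. Equivalently, in the labeled model, the number of trees on the vertex set {1,…,2g−2} in which vertices 1,…,g have degree 1, vertices g+1,…,2g−2 have degree 3, and every internal vertex is balanced, equals (g−2)!·(g−2)!. -/
/-- `IsHier g F` encodes (up to label-preserving isomorphism) a tree in `T_g`, i.e. a tree with
`g` leaves labeled `1, …, g` and all other vertices of degree `3`, rooted at the leaf `g`, by
the family `F` of descendant-leaf sets `S(v) ⊆ {1, …, g-1}` of its `g - 2` internal vertices. -/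
def IsHier (g : ℕ) (F : Finset (Finset ℕ)) : Prop :=
  (∀ A ∈ F, A ⊆ Finset.Icc 1 (g - 1)) ∧
  (∀ A ∈ F, 2 ≤ A.card) ∧
  Finset.Icc 1 (g - 1) ∈ F ∧
  (∀ A ∈ F, ∀ B ∈ F, A ⊆ B ∨ B ⊆ A ∨ Disjoint A B) ∧
  F.card = g - 2

/-- In the hierarchy encoding, an internal vertex with descendant-leaf set `A` is balanced iff
no descendant-leaf set `B ⊂ A` of another internal vertex contains both of the two smallest
labels of `A` (equivalently, the paths from the vertex to the two descendant leaves with the two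
smallest labels have no common edge).  The tree is balanced if all internal vertices are. -/
def BalancedFam (F : Finset (Finset ℕ)) : Prop :=
  ∀ A ∈ F, ∀ l₁ l₂ : ℕ, l₁ ∈ A → l₂ ∈ A → l₁ < l₂ →
    (∀ m ∈ A, m = l₁ ∨ l₂ ≤ m) →
    ¬ ∃ B ∈ F, B ⊂ A ∧ l₁ ∈ B ∧ l₂ ∈ B

/-- `ℓ` is a descendant leaf of `v` (for the tree `G` rooted at `root`): `v` lies on the
(unique) path from `ℓ` to the root. -/
def DescLeaf {N : ℕ} (G : SimpleGraph (Fin N)) (root v l : Fin N) : Prop :=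
  ∃ p : G.Walk l root, p.IsPath ∧ v ∈ p.support

/-- `v` is balanced: the paths from `v` to its two descendant leaves with the two smallest
labels (among the leaves `1, …, g-1`, i.e. vertices with `(l : ℕ) < g - 1`) have no common
edge. -/
def BalancedAt (g : ℕ) {N : ℕ} (G : SimpleGraph (Fin N)) (root v : Fin N) : Prop :=
  ∀ l₁ l₂ : Fin N, (l₁ : ℕ) < g - 1 → (l₂ : ℕ) < g - 1 →
    DescLeaf G root v l₁ → DescLeaf G root v l₂ → l₁ < l₂ →
    (∀ m : Fin N, (m : ℕ) < g - 1 → DescLeaf G root v m → m = l₁ ∨ l₂ ≤ m) →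
    ∃ p₁ : G.Walk v l₁, ∃ p₂ : G.Walk v l₂, p₁.IsPath ∧ p₂.IsPath ∧
      ∀ e, e ∈ p₁.edges → e ∉ p₂.edges

section Part1

def Lam (F : Finset (Finset ℕ)) : Prop :=
  ∀ A ∈ F, ∀ B ∈ F, A ⊆ B ∨ B ⊆ A ∨ Disjoint A B

/-- The minimal member containing `n`. -/
lemma lam_min {F : Finset (Finset ℕ)} (hF : Lam F) {n : ℕ} (h : ∃ A ∈ F, n ∈ A) :
    ∃ M ∈ F, n ∈ M ∧ ∀ A ∈ F, n ∈ A → M ⊆ A := by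
  classical
  obtain ⟨A, hA, hnA⟩ := h
  obtain ⟨M, hM, hmin⟩ := Finset.exists_min_image (F.filter (fun A => n ∈ A)) Finset.card
    ⟨A, by simp [hA, hnA]⟩
  simp only [Finset.mem_filter] at hM hmin
  refine ⟨M, hM.1, hM.2, fun B hB hnB => ?_⟩
  rcases hF M hM.1 B hB with h | h | h
  · exact h
  · exact (Finset.eq_of_subset_of_card_le h (hmin B ⟨hB, hnB⟩)).symm.subset
  · exact absurd hnB (Finset.disjoint_left.mp h hM.2)

lemma lam_erase {F : Finset (Finset ℕ)} (hF : Lam F) (n : ℕ) :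
    Lam (F.image (fun A => A.erase n)) := by
  intro A hA B hB
  simp only [Finset.mem_image] at hA hB
  obtain ⟨A, hA, rfl⟩ := hA
  obtain ⟨B, hB, rfl⟩ := hB
  rcases hF A hA B hB with h | h | h
  · exact Or.inl (Finset.erase_subset_erase _ h)
  · exact Or.inr (Or.inl (Finset.erase_subset_erase _ h))
  · exact Or.inr (Or.inr (h.mono (Finset.erase_subset _ _) (Finset.erase_subset _ _)))

lemma lam_erase_inj {F : Finset (Finset ℕ)} (hF : Lam F) (h2 : ∀ A ∈ F, 2 ≤ A.card) {n : ℕ}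
    {M : Finset ℕ} (hM : M ∈ F) (hnM : n ∈ M) (hmin : ∀ A ∈ F, n ∈ A → M ⊆ A) :
    Set.InjOn (fun A : Finset ℕ => A.erase n) (F.erase M : Finset (Finset ℕ)) := by
  have key : ∀ A ∈ F, ∀ B ∈ F, A ≠ M → n ∈ A → n ∉ B → A.erase n = B.erase n → False := by
    intro A hA B hB hAM hnA hnB he
    have hMA := hmin A hA hnA
    rw [Finset.erase_eq_of_notMem hnB] at he
    rcases hF M hM B hB with h | h | h
    · exact hnB (h hnM)
    · apply hAM
      apply Finset.Subset.antisymm _ hMA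
      intro x hx
      by_cases hxn : x = n
      · rw [hxn]; exact hnM
      · apply h; rw [← he]; simp [hx, hxn]
    · have : 1 < M.card := h2 M hM
      obtain ⟨x, hx, hxn⟩ := Finset.exists_mem_ne this n
      refine Finset.disjoint_left.mp h hx ?_
      rw [← he]; simp [hMA hx, hxn]
  intro A hA B hB he
  simp only [Finset.coe_erase, Set.mem_sdiff, Finset.mem_coe, Set.mem_singleton_iff] at hA hB
  dsimp only at he
  by_cases hnA : n ∈ A <;> by_cases hnB : n ∈ B
  · rw [← Finset.insert_erase hnA, he, Finset.insert_erase hnB]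
  · exact (key A hA.1 B hB.1 hA.2 hnA hnB he).elim
  · exact (key B hB.1 A hA.1 hB.2 hnB hnA he.symm).elim
  · rwa [Finset.erase_eq_of_notMem hnA, Finset.erase_eq_of_notMem hnB] at he

lemma lam_erase_card {F : Finset (Finset ℕ)} (h2 : ∀ A ∈ F, 2 ≤ A.card) {n : ℕ}
    {M : Finset ℕ} (hnM : n ∈ M) (hM : M ∈ F) (hmin : ∀ A ∈ F, n ∈ A → M ⊆ A)
    {A : Finset ℕ} (hA : A ∈ F) (hAM : A ≠ M) : 2 ≤ (A.erase n).card := by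
  by_cases hnA : n ∈ A
  · have : M ⊂ A := (hmin A hA hnA).ssubset_of_ne hAM.symm
    have := Finset.card_lt_card this
    have := h2 M hM
    rw [Finset.card_erase_of_mem hnA]; omega
  · rw [Finset.erase_eq_of_notMem hnA]; exact h2 A hA

lemma lam_bound (U : Finset ℕ) : ∀ F : Finset (Finset ℕ), Lam F → (∀ A ∈ F, 2 ≤ A.card) →
    (∀ A ∈ F, A ⊆ U) → F.card ≤ U.card - 1 := by
  classical
  induction U using Finset.induction_on with
  | empty =>
    intro F hF h2 hU
    have : F = ∅ := by
      apply Finset.eq_empty_of_forall_notMem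
      intro A hA
      have h1 := h2 A hA
      have := Finset.card_le_card (hU A hA)
      simp at this; simp [this] at h1
    simp [this]
  | insert n U hn ih =>
    intro F hF h2 hU
    rw [Finset.card_insert_of_notMem hn]
    by_cases h : ∃ A ∈ F, n ∈ A
    · obtain ⟨M, hM, hnM, hmin⟩ := lam_min hF h
      have hcard := Finset.card_image_of_injOn (lam_erase_inj hF h2 hM hnM hmin)
      have hb := ih ((F.erase M).image (fun A => A.erase n)) ?_ ?_ ?_
      · rw [hcard, Finset.card_erase_of_mem hM] at hb
        have h3 := h2 M hM
        have h4 := Finset.card_le_card (hU M hM)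
        rw [Finset.card_insert_of_notMem hn] at h4
        omega
      · exact lam_erase (fun A hA B hB => hF A (Finset.mem_of_mem_erase hA) B
          (Finset.mem_of_mem_erase hB)) n
      · intro A hA
        simp only [Finset.mem_image, Finset.mem_erase] at hA
        obtain ⟨A, ⟨hA1, hA2⟩, rfl⟩ := hA
        exact lam_erase_card h2 hnM hM hmin hA2 hA1
      · intro A hA
        simp only [Finset.mem_image, Finset.mem_erase] at hA
        obtain ⟨A, ⟨hA1, hA2⟩, rfl⟩ := hA
        intro x hx
        have := hU A hA2 (Finset.mem_of_mem_erase hx)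
        simp only [Finset.mem_insert] at this
        exact this.resolve_left (Finset.ne_of_mem_erase hx)
    · push Not at h
      have := ih F hF h2 (fun A hA x hx => by
        have := hU A hA hx
        simp only [Finset.mem_insert] at this
        exact this.resolve_left (fun h' => h A hA (h' ▸ hx)))
      omega

/-- Maximality: anything compatible of card ≥ 2 is in the family. -/
lemma hier_max {g : ℕ} {F : Finset (Finset ℕ)} (hF : IsHier g F) {C : Finset ℕ}
    (hC : C ⊆ Finset.Icc 1 (g - 1)) (h2 : 2 ≤ C.card)
    (hc : ∀ B ∈ F, C ⊆ B ∨ B ⊆ C ∨ Disjoint C B) : C ∈ F := by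
  classical
  by_contra hCF
  obtain ⟨hU, h2F, hfull, hlam, hcard⟩ := hF
  have := lam_bound (Finset.Icc 1 (g - 1)) (insert C F) ?_ ?_ ?_
  · rw [Finset.card_insert_of_notMem hCF, hcard] at this
    simp at this
    have := h2F _ hfull
    simp at this
    omega
  · intro A hA B hB
    rw [Finset.mem_insert] at hA hB
    rcases hA with rfl | hA <;> rcases hB with rfl | hB
    · simp
    · exact hc B hB
    · rcases hc A hA with h | h | h
      · exact Or.inr (Or.inl h)
      · exact Or.inl h
      · exact Or.inr (Or.inr h.symm)
    · exact hlam A hA B hB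
  · intro A hA
    rw [Finset.mem_insert] at hA
    rcases hA with rfl | hA
    · exact h2
    · exact h2F A hA
  · intro A hA
    rw [Finset.mem_insert] at hA
    rcases hA with rfl | hA
    · exact hC
    · exact hU A hA

/-- Binary splitting. -/
lemma hier_split {g : ℕ} {F : Finset (Finset ℕ)} (hF : IsHier g F) {A : Finset ℕ} (hA : A ∈ F) :
    ∃ X Y : Finset ℕ, Disjoint X Y ∧ X ∪ Y = A ∧ X.Nonempty ∧ Y.Nonempty ∧
      (X ∈ F ∨ X.card = 1) ∧ (Y ∈ F ∨ Y.card = 1) ∧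
      ∀ B, (B ∈ F ∨ B.card = 1) → B ⊂ A → B ⊆ X ∨ B ⊆ Y := by
  classical
  have hF' := hF
  obtain ⟨hU, h2F, hfull, hlam, hcard⟩ := hF'
  have hA2 := h2F A hA
  have hAne : A.Nonempty := Finset.card_pos.mp (by omega)
  obtain ⟨m, hm⟩ := hAne
  have hlam' : ∀ P Q : Finset ℕ, (P ∈ F ∨ P.card = 1) → (Q ∈ F ∨ Q.card = 1) →
      P ⊆ Q ∨ Q ⊆ P ∨ Disjoint P Q := by
    intro P Q hP hQ
    rcases hP with hP | hP
    · rcases hQ with hQ | hQ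
      · exact hlam P hP Q hQ
      · obtain ⟨x, rfl⟩ := Finset.card_eq_one.mp hQ
        by_cases hx : x ∈ P
        · right; left; simpa using hx
        · right; right; simpa using hx
    · obtain ⟨x, rfl⟩ := Finset.card_eq_one.mp hP
      by_cases hx : x ∈ Q
      · left; simpa using hx
      · right; right; simpa using hx
  obtain ⟨X, hX, hmax⟩ := Finset.exists_max_image
    (A.powerset.filter (fun X => (X ∈ F ∨ X.card = 1) ∧ X ⊂ A ∧ m ∈ X)) Finset.card
    ⟨{m}, by
      simp only [Finset.mem_filter, Finset.mem_powerset, Finset.singleton_subset_iff, hm,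
        Finset.card_singleton, or_true, Finset.mem_singleton, and_true, true_and]
      refine Finset.ssubset_iff_subset_ne.mpr ⟨by simpa using hm, ?_⟩
      intro h; rw [← h] at hA2; simp at hA2⟩
  simp only [Finset.mem_filter, Finset.mem_powerset] at hX hmax
  obtain ⟨hXA, hXF, hXs, hmX⟩ := hX
  have hmax' : ∀ B, (B ∈ F ∨ B.card = 1) → B ⊂ A → X ⊆ B → B = X := by
    intro B hB hBA hXB
    exact (Finset.eq_of_subset_of_card_le hXB (hmax B ⟨hBA.1, hB, hBA, hXB hmX⟩)).symm
  have hYne : (A \ X).Nonempty := by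
    rw [Finset.sdiff_nonempty]; exact hXs.2
  have hclass : ∀ B, (B ∈ F ∨ B.card = 1) → B ⊂ A → B ⊆ X ∨ B ⊆ A \ X := by
    intro B hB hBA
    rcases hlam' B X hB hXF with h | h | h
    · exact Or.inl h
    · left; rw [hmax' B hB hBA h]
    · right; exact Finset.subset_sdiff.mpr ⟨hBA.1, h⟩
  refine ⟨X, A \ X, Finset.disjoint_sdiff, Finset.union_sdiff_of_subset hXA, ⟨m, hmX⟩, hYne,
    hXF, ?_, hclass⟩
  by_cases hc : (A \ X).card = 1
  · exact Or.inr hc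
  · left
    apply hier_max hF (Finset.sdiff_subset.trans (hU A hA))
    · have := hYne.card_pos; omega
    · intro B hB
      rcases hlam A hA B hB with h | h | h
      · exact Or.inl (Finset.sdiff_subset.trans h)
      · rcases h.eq_or_ssubset with h | h
        · left; rw [h]; exact Finset.sdiff_subset
        · rcases hclass B (Or.inl hB) h with h | h
          · right; right; exact Finset.disjoint_of_subset_right h Finset.sdiff_disjoint
          · exact Or.inr (Or.inl h)
      · right; right; exact Finset.disjoint_of_subset_left Finset.sdiff_subset h

end Part1
section Part2

lemma two_smallest {A : Finset ℕ} (h : 2 ≤ A.card) :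
    ∃ l₁ ∈ A, ∃ l₂ ∈ A, l₁ < l₂ ∧ ∀ m ∈ A, m = l₁ ∨ l₂ ≤ m := by
  have h1 : A.Nonempty := Finset.card_pos.mp (by omega)
  have h2 : (A.erase (A.min' h1)).Nonempty := by
    apply Finset.card_pos.mp
    rw [Finset.card_erase_of_mem (A.min'_mem h1)]; omega
  have h3 := Finset.min'_mem _ h2
  refine ⟨A.min' h1, A.min'_mem h1, (A.erase (A.min' h1)).min' h2,
    Finset.mem_of_mem_erase h3, ?_, ?_⟩
  · exact lt_of_le_of_ne (A.min'_le _ (Finset.mem_of_mem_erase h3)) (Finset.ne_of_mem_erase h3).symm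
  · intro m hm
    by_cases hmm : m = A.min' h1
    · exact Or.inl hmm
    · right; exact Finset.min'_le _ _ (Finset.mem_erase.mpr ⟨hmm, hm⟩)

def insF (a n : ℕ) (A : Finset ℕ) : Finset ℕ := if a ∈ A then insert n A else A

lemma insF_erase {a n : ℕ} {A : Finset ℕ} (h : n ∉ A) : (insF a n A).erase n = A := by
  unfold insF; split_ifs <;> simp [h]

lemma mem_insF {a n x : ℕ} {A : Finset ℕ} : x ∈ insF a n A ↔ x ∈ A ∨ (x = n ∧ a ∈ A) := by
  unfold insF; split_ifs with h <;> simp [h]; tauto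

lemma subset_insF {a n : ℕ} {A : Finset ℕ} : A ⊆ insF a n A := by
  intro x hx; rw [mem_insF]; exact Or.inl hx

lemma insF_mono {a n : ℕ} {A B : Finset ℕ} (h : A ⊆ B) : insF a n A ⊆ insF a n B := by
  intro x hx; rw [mem_insF] at *
  exact hx.imp (fun h' => h h') (fun h' => ⟨h'.1, h h'.2⟩)

def upF (g a : ℕ) (F : Finset (Finset ℕ)) : Finset (Finset ℕ) :=
  insert {a, g} (F.image (insF a g))

lemma hier_notMem {g : ℕ} {F : Finset (Finset ℕ)} (hg : 3 ≤ g) (hF : IsHier g F) {A : Finset ℕ}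
    (hA : A ∈ F) : g ∉ A := by
  intro h
  have := hF.1 A hA h
  simp at this; omega

lemma insF_ne_pair {g a b : ℕ} {F : Finset (Finset ℕ)} (hg : 3 ≤ g) (hF : IsHier g F)
    {A : Finset ℕ} (hA : A ∈ F) (ha : a ≠ g) : insF b g A ≠ {a, g} := by
  intro h
  have h1 := insF_erase (a := b) (hier_notMem hg hF hA)
  rw [h] at h1
  have h2 := hF.2.1 A hA
  rw [← h1, Finset.card_erase_of_mem (by simp), Finset.card_pair ha] at h2
  omega

lemma upF_hier {g a : ℕ} {F : Finset (Finset ℕ)} (hg : 3 ≤ g) (hF : IsHier g F)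
    (ha : a ∈ Finset.Icc 1 (g - 1)) : IsHier (g + 1) (upF g a F) := by
  have hF' := hF
  obtain ⟨hU, h2F, hfull, hlam, hcard⟩ := hF'
  rw [Finset.mem_Icc] at ha
  have hag : a ≠ g := by omega
  have hpair : ∀ A ∈ F, insF a g A ⊆ {a, g} ∨ {a, g} ⊆ insF a g A ∨ Disjoint (insF a g A) {a, g} := by
    intro A hA
    by_cases haA : a ∈ A
    · right; left
      intro x hx
      simp only [Finset.mem_insert, Finset.mem_singleton] at hx
      rw [mem_insF]
      rcases hx with rfl | rfl
      · exact Or.inl haA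
      · exact Or.inr ⟨rfl, haA⟩
    · right; right
      have := hier_notMem hg hF hA
      simp [insF, haA, this]
  refine ⟨?_, ?_, ?_, ?_, ?_⟩
  · intro A hA
    simp only [upF, Finset.mem_insert, Finset.mem_image] at hA
    intro x hx
    rcases hA with rfl | ⟨A, hA, rfl⟩
    · simp at hx ⊢; omega
    · rw [mem_insF] at hx
      rcases hx with hx | hx
      · have := hU A hA hx
        simp at this ⊢; omega
      · simp; omega
  · intro A hA
    simp only [upF, Finset.mem_insert, Finset.mem_image] at hA
    rcases hA with rfl | ⟨A, hA, rfl⟩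
    · rw [Finset.card_pair hag]
    · exact (h2F A hA).trans (Finset.card_le_card subset_insF)
  · simp only [upF, Finset.mem_insert, Finset.mem_image]
    right
    refine ⟨_, hfull, ?_⟩
    ext x
    rw [mem_insF]
    simp only [Finset.mem_Icc]
    omega
  · intro A hA B hB
    simp only [upF, Finset.mem_insert, Finset.mem_image] at hA hB
    rcases hA with rfl | ⟨A, hA, rfl⟩ <;> rcases hB with rfl | ⟨B, hB, rfl⟩
    · simp
    · have := hpair B hB
      rw [disjoint_comm]; tauto
    · exact hpair A hA
    · rcases hlam A hA B hB with h | h | h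
      · exact Or.inl (insF_mono h)
      · exact Or.inr (Or.inl (insF_mono h))
      · right; right
        have h1 := hier_notMem hg hF hA
        have h2 := hier_notMem hg hF hB
        rw [Finset.disjoint_left] at h ⊢
        intro x hx hx'
        rw [mem_insF] at hx hx'
        rcases hx with hx | ⟨rfl, hx⟩ <;> rcases hx' with hx' | ⟨hx'', hx'⟩
        · exact h hx hx'
        · exact h1 (hx'' ▸ hx)
        · exact h2 hx'
        · exact h hx hx'
  · unfold upF
    rw [Finset.card_insert_of_notMem, Finset.card_image_of_injOn, hcard]
    · omega
    · intro A hA B hB h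
      rw [← insF_erase (a := a) (hier_notMem hg hF hA), h, insF_erase (hier_notMem hg hF hB)]
    · intro h
      rw [Finset.mem_image] at h
      obtain ⟨A, hA, h⟩ := h
      exact insF_ne_pair hg hF hA hag h

lemma upF_bal {g a : ℕ} {F : Finset (Finset ℕ)} (hg : 3 ≤ g) (hF : IsHier g F)
    (hb : BalancedFam F) (ha : a ∈ Finset.Icc 1 (g - 1)) : BalancedFam (upF g a F) := by
  have hup := upF_hier hg hF ha
  rw [Finset.mem_Icc] at ha
  have hag : a ≠ g := by omega
  have hlt : ∀ A ∈ F, ∀ x ∈ A, x < g := by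
    intro A hA x hx
    have := hF.1 A hA hx
    simp at this; omega
  intro A hA l₁ l₂ h1 h2 hl hmin ⟨B, hB, hBA, hB1, hB2⟩
  have hBc := hup.2.1 B hB
  simp only [upF, Finset.mem_insert, Finset.mem_image] at hA hB
  rcases hA with rfl | ⟨A, hA, rfl⟩
  · have := Finset.card_lt_card hBA
    rw [Finset.card_pair hag] at this
    omega
  · have hl2 : l₂ ≠ g := by
      rintro rfl
      have hA2 := hF.2.1 A hA
      obtain ⟨x, hx, hx1⟩ := Finset.exists_mem_ne hA2 l₁
      have h3 := hlt A hA x hx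
      rcases hmin x (subset_insF hx) with h | h
      · exact hx1 h
      · omega
    have hl1 : l₁ ≠ g := by
      rintro rfl
      rw [mem_insF] at h2
      rcases h2 with h2 | h2
      · have := hlt A hA _ h2; omega
      · omega
    have h1' : l₁ ∈ A := by
      rw [mem_insF] at h1; exact h1.resolve_right (fun h => hl1 h.1)
    have h2' : l₂ ∈ A := by
      rw [mem_insF] at h2; exact h2.resolve_right (fun h => hl2 h.1)
    rcases hB with rfl | ⟨B, hB, rfl⟩
    · simp at hB1 hB2; omega
    · refine hb A hA l₁ l₂ h1' h2' hl (fun m hm => hmin m (subset_insF hm)) ⟨B, hB, ?_, ?_, ?_⟩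
      · refine Finset.ssubset_iff_subset_ne.mpr ⟨?_, ?_⟩
        · have := Finset.erase_subset_erase g hBA.1
          rwa [insF_erase (hier_notMem hg hF hA), insF_erase (hier_notMem hg hF hB)] at this
        · rintro rfl
          exact hBA.2 (Finset.Subset.refl _)
      · rw [mem_insF] at hB1; exact hB1.resolve_right (fun h => hl1 h.1)
      · rw [mem_insF] at hB2; exact hB2.resolve_right (fun h => hl2 h.1)

lemma upF_inj {g a b : ℕ} {F F' : Finset (Finset ℕ)} (hg : 3 ≤ g) (hF : IsHier g F)
    (hF' : IsHier g F') (ha : a ∈ Finset.Icc 1 (g - 1)) (hb : b ∈ Finset.Icc 1 (g - 1))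
    (h : upF g a F = upF g b F') : a = b ∧ F = F' := by
  rw [Finset.mem_Icc] at ha hb
  have hab : a = b := by
    have h1 : {a, g} ∈ upF g b F' := by rw [← h]; simp [upF]
    simp only [upF, Finset.mem_insert, Finset.mem_image] at h1
    rcases h1 with h1 | ⟨B, hB, h1⟩
    · have : a ∈ ({b, g} : Finset ℕ) := by rw [← h1]; simp
      simp at this; omega
    · exact (insF_ne_pair hg hF' hB (by omega) h1).elim
  subst hab
  refine ⟨rfl, ?_⟩
  have key : ∀ F F' : Finset (Finset ℕ), IsHier g F → IsHier g F' → upF g a F = upF g a F' →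
      F ⊆ F' := by
    intro F F' hF hF' h A hA
    have h1 : insF a g A ∈ upF g a F' := by
      rw [← h]; simp only [upF, Finset.mem_insert, Finset.mem_image]; exact Or.inr ⟨A, hA, rfl⟩
    simp only [upF, Finset.mem_insert, Finset.mem_image] at h1
    rcases h1 with h1 | ⟨B, hB, h1⟩
    · exact (insF_ne_pair hg hF hA (by omega) h1).elim
    · rw [← insF_erase (a := a) (hier_notMem hg hF hA), ← h1,
        insF_erase (hier_notMem hg hF' hB)]
      exact hB
  exact Finset.Subset.antisymm (key F F' hF hF' h) (key F' F hF' hF h.symm)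

lemma upF_surj {g : ℕ} {F : Finset (Finset ℕ)} (hg : 3 ≤ g) (hF : IsHier (g + 1) F)
    (hb : BalancedFam F) : ∃ F' a, IsHier g F' ∧ BalancedFam F' ∧ a ∈ Finset.Icc 1 (g - 1) ∧
      upF g a F' = F := by
  have hF' := hF
  obtain ⟨hU, h2F, hfull, hlam, hcard⟩ := hF'
  simp only [Nat.add_sub_cancel] at hU hfull
  have hcard' : F.card = g - 1 := by omega
  have hle : ∀ A ∈ F, ∀ x ∈ A, 1 ≤ x ∧ x ≤ g := by
    intro A hA x hx
    have := hU A hA hx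
    simpa using this
  obtain ⟨M, hM, hgM, hmin⟩ := lam_min (n := g) hlam ⟨_, hfull, by simp; omega⟩
  have hM2 : M.card = 2 := by
    by_contra hne
    have h3 : 3 ≤ M.card := by have := h2F M hM; omega
    have hc : (M.erase g).card = M.card - 1 := Finset.card_erase_of_mem hgM
    have hE : M.erase g ∈ F := by
      apply hier_max hF ((Finset.erase_subset _ _).trans (hF.1 M hM))
      · omega
      · intro B hB
        rcases hlam M hM B hB with h | h | h
        · exact Or.inl ((Finset.erase_subset _ _).trans h)
        · by_cases hgB : g ∈ B
          · exact Or.inl ((Finset.erase_subset _ _).trans (hmin B hB hgB))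
          · right; left; exact Finset.subset_erase.mpr ⟨h, hgB⟩
        · right; right; exact Finset.disjoint_of_subset_left (Finset.erase_subset _ _) h
    obtain ⟨l₁, h1, l₂, h2, hl, hm⟩ := two_smallest (A := M.erase g) (by omega)
    rw [Finset.mem_erase] at h1 h2
    refine hb M hM l₁ l₂ h1.2 h2.2 hl ?_ ⟨_, hE, Finset.erase_ssubset hgM, ?_, ?_⟩
    · intro m hmM
      by_cases hmg : m = g
      · right; rw [hmg]; exact (hle M hM _ h2.2).2
      · exact hm m (Finset.mem_erase.mpr ⟨hmg, hmM⟩)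
    · exact Finset.mem_erase.mpr h1
    · exact Finset.mem_erase.mpr h2
  obtain ⟨a, ha⟩ := Finset.card_eq_one.mp (show (M.erase g).card = 1 by
    rw [Finset.card_erase_of_mem hgM]; omega)
  have hMa : M = {a, g} := by
    rw [← Finset.insert_erase hgM, ha, Finset.pair_comm]
  have haM : a ∈ M.erase g := by simp [ha]
  rw [Finset.mem_erase] at haM
  have hale := hle M hM a haM.2
  have hiff : ∀ A ∈ F, A ≠ M → (a ∈ A ↔ g ∈ A) := by
    intro A hA hAM
    rcases hlam A hA M hM with h | h | h
    · have h1 := Finset.card_lt_card (h.ssubset_of_ne hAM)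
      have := h2F A hA
      omega
    · exact ⟨fun _ => h hgM, fun _ => h haM.2⟩
    · rw [Finset.disjoint_right] at h
      exact ⟨fun h' => (h haM.2 h').elim, fun h' => (h hgM h').elim⟩
  have hMfull : Finset.Icc 1 g ≠ M := by
    intro h; rw [← h] at hM2; simp at hM2; omega
  have hins : ∀ A ∈ F, A ≠ M → insF a g (A.erase g) = A := by
    intro A hA hAM
    have := hiff A hA hAM
    ext x
    rw [mem_insF]
    simp only [Finset.mem_erase]
    constructor
    · rintro (h | ⟨rfl, h⟩)
      · exact h.2
      · exact this.mp h.2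
    · intro hx
      by_cases hxg : x = g
      · right; subst hxg; exact ⟨rfl, haM.1, this.mpr hx⟩
      · exact Or.inl ⟨hxg, hx⟩
  refine ⟨(F.erase M).image (fun A => A.erase g), a, ⟨?_, ?_, ?_, ?_, ?_⟩, ?_, ?_, ?_⟩
  · intro A hA
    simp only [Finset.mem_image, Finset.mem_erase] at hA
    obtain ⟨A, ⟨hAM, hA⟩, rfl⟩ := hA
    intro x hx
    rw [Finset.mem_erase] at hx
    have := hle A hA x hx.2
    rw [Finset.mem_Icc]; omega
  · intro A hA
    simp only [Finset.mem_image, Finset.mem_erase] at hA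
    obtain ⟨A, ⟨hAM, hA⟩, rfl⟩ := hA
    exact lam_erase_card h2F hgM hM hmin hA hAM
  · simp only [Finset.mem_image, Finset.mem_erase]
    refine ⟨_, ⟨hMfull, hfull⟩, ?_⟩
    ext x
    simp only [Finset.mem_erase, Finset.mem_Icc]
    omega
  · exact lam_erase (fun A hA B hB => hlam A (Finset.mem_of_mem_erase hA) B
      (Finset.mem_of_mem_erase hB)) g
  · rw [Finset.card_image_of_injOn (lam_erase_inj hlam h2F hM hgM hmin),
      Finset.card_erase_of_mem hM]
    omega
  · intro A hA l₁ l₂ h1 h2 hl hm ⟨B, hB, hBA, hB1, hB2⟩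
    simp only [Finset.mem_image, Finset.mem_erase] at hA hB
    obtain ⟨A, ⟨hAM, hA⟩, rfl⟩ := hA
    obtain ⟨B, ⟨hBM, hB⟩, rfl⟩ := hB
    rw [Finset.mem_erase] at h1 h2 hB1 hB2
    refine hb A hA l₁ l₂ h1.2 h2.2 hl ?_ ⟨B, hB, ?_, hB1.2, hB2.2⟩
    · intro m hmA
      by_cases hmg : m = g
      · right; rw [hmg]; exact (hle A hA _ h2.2).2
      · exact hm m (Finset.mem_erase.mpr ⟨hmg, hmA⟩)
    · rw [← hins A hA hAM, ← hins B hB hBM]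
      refine Finset.ssubset_iff_subset_ne.mpr ⟨insF_mono hBA.1, ?_⟩
      rw [hins A hA hAM, hins B hB hBM]
      rintro rfl
      exact hBA.2 (Finset.Subset.refl _)
  · rw [Finset.mem_Icc]; omega
  · unfold upF
    rw [← hMa, Finset.image_image]
    have : (F.erase M).image (insF a g ∘ fun A => A.erase g) = F.erase M := by
      rw [Finset.image_congr (g := id)]
      · simp
      · intro A hA
        rw [Finset.mem_coe, Finset.mem_erase] at hA
        exact hins A hA.2 hA.1
    rw [this, Finset.insert_erase hM]

lemma hier_count (g : ℕ) (hg : 3 ≤ g) :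
    Nat.card {F : Finset (Finset ℕ) // IsHier g F ∧ BalancedFam F} = Nat.factorial (g - 2) := by
  induction g, hg using Nat.le_induction with
  | base =>
    have : ∀ F, (IsHier 3 F ∧ BalancedFam F) ↔ F = {Finset.Icc 1 2} := by
      intro F
      constructor
      · rintro ⟨⟨h1, h2, h3, h4, h5⟩, h⟩
        obtain ⟨A, rfl⟩ := Finset.card_eq_one.mp h5
        simp only [Finset.mem_singleton] at h3
        rw [← h3]
      · rintro rfl
        refine ⟨⟨?_, ?_, ?_, ?_, ?_⟩, ?_⟩
        · simp
        · simp
        · simp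
        · simp
        · simp
        · intro A hA l₁ l₂ h1 h2 hl hm ⟨B, hB, hBA, hB1, hB2⟩
          rw [Finset.mem_singleton] at hA hB
          rw [hA, hB] at hBA
          exact hBA.2 (Finset.Subset.refl _)
    simp [this]
  | succ g hg ih =>
    let f : {F : Finset (Finset ℕ) // IsHier g F ∧ BalancedFam F} × {a // a ∈ Finset.Icc 1 (g - 1)} →
        {F : Finset (Finset ℕ) // IsHier (g + 1) F ∧ BalancedFam F} :=
      fun x => ⟨upF g x.2.1 x.1.1, upF_hier hg x.1.2.1 x.2.2, upF_bal hg x.1.2.1 x.1.2.2 x.2.2⟩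
    have hf : Function.Bijective f := by
      constructor
      · rintro ⟨⟨F, hF⟩, ⟨a, ha⟩⟩ ⟨⟨F', hF'⟩, ⟨b, hb⟩⟩ h
        have := upF_inj hg hF.1 hF'.1 ha hb (Subtype.ext_iff.mp h)
        obtain ⟨rfl, rfl⟩ := this
        rfl
      · rintro ⟨F, hF⟩
        obtain ⟨F', a, h1, h2, h3, h4⟩ := upF_surj hg hF.1 hF.2
        exact ⟨⟨⟨F', h1, h2⟩, ⟨a, h3⟩⟩, Subtype.ext h4⟩
    rw [← Nat.card_congr (Equiv.ofBijective f hf), Nat.card_prod, ih]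
    have : Nat.card {a // a ∈ Finset.Icc 1 (g - 1)} = g - 1 := by
      rw [Nat.card_eq_fintype_card, Fintype.card_coe]; simp
    rw [this]
    obtain ⟨k, rfl⟩ : ∃ k, g = k + 2 := ⟨g - 2, by omega⟩
    rw [show k + 2 + 1 - 2 = k + 1 by omega, Nat.factorial_succ]
    simp [mul_comm]

end Part2
section Part3

variable {V : Type*}

structure IsPar (r : V) (par : V → V) : Prop where
  root : par r = r
  reach : ∀ v, ∃ k, par^[k] v = r

/-- `v` is a (weak) ancestor of `x`. -/
def Anc (par : V → V) (v x : V) : Prop := ∃ k, par^[k] x = v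

lemma Anc.refl (par : V → V) (v : V) : Anc par v v := ⟨0, rfl⟩

lemma Anc.trans {par : V → V} {u v w : V} (h : Anc par u v) (h' : Anc par v w) : Anc par u w := by
  obtain ⟨j, rfl⟩ := h
  obtain ⟨k, rfl⟩ := h'
  exact ⟨j + k, by rw [Function.iterate_add_apply]⟩

lemma Anc.par (par : V → V) (v : V) : Anc par (par v) v := ⟨1, rfl⟩

lemma anc_iff {par : V → V} {v x : V} : Anc par v x ↔ x = v ∨ Anc par v (par x) := by
  constructor
  · rintro ⟨k, hk⟩
    cases k with
    | zero => exact Or.inl hk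
    | succ k => right; exact ⟨k, by rwa [Function.iterate_succ_apply] at hk⟩
  · rintro (rfl | h)
    · exact Anc.refl _ _
    · exact h.trans (Anc.par _ _)

lemma Anc.total {par : V → V} {u v x : V} (h : Anc par u x) (h' : Anc par v x) :
    Anc par u v ∨ Anc par v u := by
  obtain ⟨j, rfl⟩ := h
  obtain ⟨k, rfl⟩ := h'
  rcases le_total j k with h | h
  · right; exact ⟨k - j, by rw [← Function.iterate_add_apply, Nat.sub_add_cancel h]⟩
  · left; exact ⟨j - k, by rw [← Function.iterate_add_apply, Nat.sub_add_cancel h]⟩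

lemma IsPar.anc_root {r : V} {par : V → V} (hp : IsPar r par) (v : V) : Anc par r v := hp.reach v

lemma IsPar.iter_root {r : V} {par : V → V} (hp : IsPar r par) (k : ℕ) : par^[k] r = r :=
  Function.iterate_fixed hp.root k

lemma IsPar.eq_root {r : V} {par : V → V} (hp : IsPar r par) {v : V} (h : Anc par v r) : v = r := by
  obtain ⟨k, rfl⟩ := h
  exact hp.iter_root k

lemma IsPar.antisymm {r : V} {par : V → V} (hp : IsPar r par) {u v : V} (h : Anc par u v)
    (h' : Anc par v u) : u = v := by
  obtain ⟨j, rfl⟩ := h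
  obtain ⟨k, hk⟩ := h'
  cases j with
  | zero => rfl
  | succ j =>
    have hper : par^[k + (j + 1)] v = v := by rw [Function.iterate_add_apply]; exact hk
    obtain ⟨m, hm⟩ := hp.reach v
    have h1 : par^[(k + (j + 1)) * m] v = v := by
      rw [Function.iterate_mul]; exact Function.iterate_fixed hper m
    have h2 : (k + (j + 1)) * m = ((k + j) * m) + m := by ring
    rw [h2, Function.iterate_add_apply, hm, hp.iter_root] at h1
    rw [← h1, hp.iter_root]

lemma IsPar.par_ne {r : V} {par : V → V} (hp : IsPar r par) {v : V} (hv : v ≠ r) : par v ≠ v := by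
  intro h
  obtain ⟨m, hm⟩ := hp.reach v
  rw [Function.iterate_fixed h] at hm
  exact hv hm

lemma IsPar.not_anc_par {r : V} {par : V → V} (hp : IsPar r par) {v : V} (hv : v ≠ r) :
    ¬ Anc par v (par v) := fun h => hp.par_ne hv (hp.antisymm (Anc.par _ _) h)

/-- a strict descendant passes through a child -/
lemma IsPar.child {r : V} {par : V → V} (hp : IsPar r par) {v x : V} (h : Anc par v x)
    (hne : x ≠ v) : ∃ c, par c = v ∧ c ≠ r ∧ Anc par c x := by
  obtain ⟨k, hk⟩ := h
  induction k generalizing x with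
  | zero => exact (hne hk).elim
  | succ k ih =>
    rw [Function.iterate_succ_apply] at hk
    by_cases h1 : par x = v
    · refine ⟨x, h1, ?_, Anc.refl _ _⟩
      rintro rfl
      rw [hp.root] at h1
      exact hne h1
    · obtain ⟨c, hc1, hc2, hc3⟩ := ih h1 hk
      exact ⟨c, hc1, hc2, hc3.trans (Anc.par _ _)⟩

/-- two distinct siblings have disjoint descendants -/
lemma IsPar.sibling {r : V} {par : V → V} (hp : IsPar r par) {c d x : V} (hc : c ≠ r)
    (hd : d ≠ r) (hcd : par c = par d) (h1 : Anc par c x) (h2 : Anc par d x) : c = d := by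
  rcases h1.total h2 with h | h
  · rcases anc_iff.mp h with h | h
    · exact h.symm
    · rw [← hcd] at h; exact (hp.not_anc_par hc h).elim
  · rcases anc_iff.mp h with h | h
    · exact h
    · rw [hcd] at h; exact (hp.not_anc_par hd h).elim

def graphOf (par : V → V) : SimpleGraph V := SimpleGraph.fromRel (fun x y => par x = y)

lemma graphOf_adj {par : V → V} {x y : V} :
    (graphOf par).Adj x y ↔ x ≠ y ∧ (par x = y ∨ par y = x) := by
  simp [graphOf]

lemma IsPar.adj {r : V} {par : V → V} (hp : IsPar r par) {v : V} (hv : v ≠ r) :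
    (graphOf par).Adj v (par v) := graphOf_adj.mpr ⟨(hp.par_ne hv).symm, Or.inl rfl⟩

lemma IsPar.path {r : V} {par : V → V} (hp : IsPar r par) {v x : V} (h : Anc par v x) :
    ∃ p : (graphOf par).Walk x v, p.IsPath ∧
      (∀ y, y ∈ p.support ↔ Anc par v y ∧ Anc par y x) ∧
      (∀ e, e ∈ p.edges ↔ ∃ y, y ≠ v ∧ Anc par v y ∧ Anc par y x ∧ e = s(y, par y)) := by
  obtain ⟨k, hk⟩ := h
  induction k generalizing x with
  | zero =>
    obtain rfl : x = v := hk
    refine ⟨SimpleGraph.Walk.nil, by simp, ?_, ?_⟩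
    · intro y
      simp only [SimpleGraph.Walk.support_nil, List.mem_singleton]
      constructor
      · rintro rfl; exact ⟨Anc.refl _ _, Anc.refl _ _⟩
      · rintro ⟨h1, h2⟩; exact hp.antisymm h2 h1
    · intro e
      simp only [SimpleGraph.Walk.edges_nil, List.not_mem_nil, false_iff]
      rintro ⟨y, hy, h1, h2, -⟩
      exact hy (hp.antisymm h2 h1)
  | succ k ih =>
    rw [Function.iterate_succ_apply] at hk
    by_cases hxv : x = v
    · subst hxv
      have hx : x = r := by
        by_contra hx
        exact hp.not_anc_par hx ⟨k, hk⟩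
      exact ih (by rw [hx]; exact hp.iter_root k)
    · have hxr : x ≠ r := by
        rintro rfl
        rw [hp.root, hp.iter_root] at hk
        exact hxv hk
      obtain ⟨p, hp1, hp2, hp3⟩ := ih hk
      have hvx : Anc par v (par x) := ⟨k, hk⟩
      refine ⟨SimpleGraph.Walk.cons (hp.adj hxr) p, ?_, ?_, ?_⟩
      · rw [SimpleGraph.Walk.cons_isPath_iff]
        refine ⟨hp1, fun h => hp.not_anc_par hxr ((hp2 x).mp h).2⟩
      · intro y
        rw [SimpleGraph.Walk.support_cons, List.mem_cons, hp2, anc_iff (x := x)]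
        constructor
        · rintro (rfl | h)
          · exact ⟨hvx.trans (Anc.par _ _), Or.inl rfl⟩
          · exact ⟨h.1, Or.inr h.2⟩
        · rintro ⟨h1, rfl | h2⟩
          · exact Or.inl rfl
          · exact Or.inr ⟨h1, h2⟩
      · intro e
        rw [SimpleGraph.Walk.edges_cons, List.mem_cons, hp3]
        constructor
        · rintro (rfl | ⟨y, h1, h2, h3, h4⟩)
          · exact ⟨x, hxv, hvx.trans (Anc.par _ _), Anc.refl _ _, rfl⟩
          · exact ⟨y, h1, h2, h3.trans (Anc.par _ _), h4⟩
        · rintro ⟨y, h1, h2, h3, h4⟩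
          rcases anc_iff.mp h3 with rfl | h3
          · exact Or.inl h4
          · exact Or.inr ⟨y, h1, h2, h3, h4⟩

lemma IsPar.connected {r : V} {par : V → V} (hp : IsPar r par) : (graphOf par).Connected := by
  have h : ∀ v, (graphOf par).Reachable v r := fun v => by
    obtain ⟨p, -⟩ := hp.path (hp.anc_root v)
    exact ⟨p⟩
  exact { preconnected := fun u v => (h u).trans (h v).symm, nonempty := ⟨r⟩ }

lemma IsPar.isTree [Finite V] {r : V} {par : V → V} (hp : IsPar r par) : (graphOf par).IsTree := by
  classical
  rw [SimpleGraph.isTree_iff_connected_and_card]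
  refine ⟨hp.connected, le_antisymm ?_ hp.connected.card_vert_le_card_edgeSet_add_one⟩
  have hsub : (graphOf par).edgeSet ⊆ (fun v => s(v, par v)) '' {v | v ≠ r} := by
    intro e
    induction e using Sym2.ind with
    | _ x y =>
      rw [SimpleGraph.mem_edgeSet, graphOf_adj]
      rintro ⟨hne, h | h⟩
      · refine ⟨x, ?_, by simp [h]⟩
        rintro rfl; rw [hp.root] at h; exact hne h
      · refine ⟨y, ?_, by simp [h, Sym2.eq_swap]⟩
        rintro rfl; rw [hp.root] at h; exact hne h.symm
  have h1 : (graphOf par).edgeSet.ncard ≤ ({v | v ≠ r} : Set V).ncard :=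
    (Set.ncard_le_ncard hsub (Set.toFinite _)).trans (Set.ncard_image_le (Set.toFinite _))
  have h2 : ({v | v ≠ r} : Set V).ncard + 1 = Nat.card V := by
    have : ({v | v ≠ r} : Set V) = ({r} : Set V)ᶜ := by ext; simp
    rw [this, Set.ncard_compl, Set.ncard_singleton]
    have : 0 < Nat.card V := Nat.card_pos_iff.mpr ⟨⟨r⟩, inferInstance⟩
    omega
  rw [Nat.card_coe_set_eq]
  omega

lemma exists_par [Finite V] {G : SimpleGraph V} (hG : G.IsTree) (r : V) :
    ∃ par, IsPar r par ∧ G = graphOf par := by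
  classical
  have h : ∀ v, ∃ w, v ≠ r → G.Adj v w ∧ G.dist w r < G.dist v r := by
    intro v
    by_cases hv : v = r
    · exact ⟨v, fun h => (h hv).elim⟩
    obtain ⟨p, hp⟩ := hG.connected.exists_walk_length_eq_dist v r
    cases p with
    | nil => exact (hv rfl).elim
    | @cons _ w _ hadj q =>
      refine ⟨w, fun _ => ⟨hadj, ?_⟩⟩
      rw [← hp, SimpleGraph.Walk.length_cons]
      have := SimpleGraph.dist_le q
      omega
  choose f hf using h
  let par : V → V := fun v => if v = r then r else f v
  have hpar : ∀ v, v ≠ r → par v = f v := fun v hv => by simp [par, hv]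
  have hP : IsPar r par := by
    refine ⟨by simp [par], ?_⟩
    suffices ∀ n v, G.dist v r = n → ∃ k, par^[k] v = r from fun v => this _ v rfl
    intro n
    induction n using Nat.strong_induction_on with
    | _ n ih =>
      intro v hv
      by_cases hvr : v = r
      · exact ⟨0, hvr⟩
      · obtain ⟨k, hk⟩ := ih (G.dist (f v) r) (by rw [← hv]; exact (hf v hvr).2) (f v) rfl
        exact ⟨k + 1, by rw [Function.iterate_succ_apply, hpar v hvr, hk]⟩
  refine ⟨par, hP, ?_⟩
  have hle : graphOf par ≤ G := by
    intro x y hxy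
    rw [graphOf_adj] at hxy
    obtain ⟨hne, h | h⟩ := hxy
    · have hx : x ≠ r := by rintro rfl; rw [hP.root] at h; exact hne h
      rw [hpar x hx] at h
      rw [← h]; exact (hf x hx).1
    · have hx : y ≠ r := by rintro rfl; rw [hP.root] at h; exact hne h.symm
      rw [hpar y hx] at h
      rw [← h]; exact (hf y hx).1.symm
  exact le_antisymm ((SimpleGraph.isTree_iff_minimal_connected.mp hG).2 hP.connected hle) hle

lemma IsPar.ncard_nbr [Finite V] {r : V} {par : V → V} (hp : IsPar r par) (v : V) [Decidable (v = r)] :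
    ((graphOf par).neighborSet v).ncard =
      {c | c ≠ r ∧ par c = v}.ncard + if v = r then 0 else 1 := by
  classical
  split_ifs with hv
  · have : (graphOf par).neighborSet v = {c | c ≠ r ∧ par c = v} := by
      ext c
      rw [SimpleGraph.mem_neighborSet, graphOf_adj, Set.mem_ofPred_eq]
      subst hv
      constructor
      · rintro ⟨h1, h | h⟩
        · rw [hp.root] at h; exact (h1 h).elim
        · exact ⟨h1.symm, h⟩
      · rintro ⟨h1, h2⟩; exact ⟨h1.symm, Or.inr h2⟩
    rw [this]; rfl
  · have : (graphOf par).neighborSet v = insert (par v) {c | c ≠ r ∧ par c = v} := by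
      ext c
      rw [SimpleGraph.mem_neighborSet, graphOf_adj, Set.mem_insert_iff, Set.mem_ofPred_eq]
      constructor
      · rintro ⟨h1, h | h⟩
        · exact Or.inl h.symm
        · refine Or.inr ⟨?_, h⟩
          rintro rfl; rw [hp.root] at h; exact h1 h.symm
      · rintro (rfl | ⟨h1, h2⟩)
        · exact ⟨(hp.par_ne hv).symm, Or.inl rfl⟩
        · refine ⟨?_, Or.inr h2⟩
          rintro rfl; exact hp.par_ne hv h2
    rw [this, Set.ncard_insert_of_notMem]
    rintro ⟨-, h⟩
    exact hp.not_anc_par hv ⟨1, h⟩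

lemma IsPar.descLeaf {N : ℕ} {r : Fin N} {par : Fin N → Fin N} (hp : IsPar r par) {v l : Fin N} :
    DescLeaf (graphOf par) r v l ↔ Anc par v l := by
  obtain ⟨q, hq, hq2, -⟩ := hp.path (hp.anc_root l)
  constructor
  · rintro ⟨p, hpp, hv⟩
    have := (hp.isTree.existsUnique_path l r).unique hpp hq
    rw [this] at hv
    exact ((hq2 v).mp hv).2
  · intro h
    exact ⟨q, hq, (hq2 v).mpr ⟨hp.anc_root v, h⟩⟩

lemma IsPar.edges_disj [Finite V] {r : V} {par : V → V} (hp : IsPar r par) {v l₁ l₂ : V}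
    (h1 : Anc par v l₁) (h2 : Anc par v l₂) :
    (∃ p₁ : (graphOf par).Walk v l₁, ∃ p₂ : (graphOf par).Walk v l₂, p₁.IsPath ∧ p₂.IsPath ∧
      ∀ e, e ∈ p₁.edges → e ∉ p₂.edges) ↔
    ¬ ∃ y, y ≠ v ∧ Anc par v y ∧ Anc par y l₁ ∧ Anc par y l₂ := by
  obtain ⟨q1, hq1, -, he1⟩ := hp.path h1
  obtain ⟨q2, hq2, -, he2⟩ := hp.path h2
  constructor
  · rintro ⟨p1, p2, hp1, hp2, hd⟩ ⟨y, hy, hy1, hy2, hy3⟩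
    have e1 := (hp.isTree.existsUnique_path v l₁).unique hp1 hq1.reverse
    have e2 := (hp.isTree.existsUnique_path v l₂).unique hp2 hq2.reverse
    subst e1 e2
    apply hd s(y, par y)
    · rw [SimpleGraph.Walk.edges_reverse, List.mem_reverse, he1]
      exact ⟨y, hy, hy1, hy2, rfl⟩
    · rw [SimpleGraph.Walk.edges_reverse, List.mem_reverse, he2]
      exact ⟨y, hy, hy1, hy3, rfl⟩
  · intro h
    refine ⟨q1.reverse, q2.reverse, hq1.reverse, hq2.reverse, ?_⟩
    intro e he he'
    rw [SimpleGraph.Walk.edges_reverse, List.mem_reverse] at he he'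
    rw [he1] at he
    rw [he2] at he'
    obtain ⟨y, hy1, hy2, hy3, rfl⟩ := he
    obtain ⟨z, hz1, hz2, hz3, hz⟩ := he'
    have hyz : y = z := by
      rw [Sym2.eq_iff] at hz
      rcases hz with hz | hz
      · exact hz.1
      · have ha : Anc par y z := ⟨1, hz.1.symm⟩
        have hb : Anc par z y := ⟨1, hz.2⟩
        exact hp.antisymm ha hb
    subst hyz
    exact h ⟨y, hy1, hy2, hy3, hz3⟩

end Part3
section Part4

structure Cub (g : ℕ) (r : Fin (2 * g - 2)) (par : Fin (2 * g - 2) → Fin (2 * g - 2)) : Prop where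
  rv : (r : ℕ) = g - 1
  isPar : IsPar r par
  leaf : ∀ v : Fin (2 * g - 2), (v : ℕ) < g - 1 → ∀ c, c ≠ r → par c ≠ v
  rootc : ∃ c, c ≠ r ∧ par c = r ∧ ∀ d, d ≠ r → par d = r → d = c
  intc : ∀ v : Fin (2 * g - 2), g ≤ (v : ℕ) → ∃ c d, c ≠ d ∧ c ≠ r ∧ d ≠ r ∧ par c = v ∧ par d = v ∧
    ∀ e, e ≠ r → par e = v → e = c ∨ e = d

lemma cub_iff {g : ℕ} (hg : 3 ≤ g) {r : Fin (2 * g - 2)} (hr : (r : ℕ) = g - 1)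
    {par : Fin (2 * g - 2) → Fin (2 * g - 2)} (hp : IsPar r par) :
    (∀ v : Fin (2 * g - 2), ((graphOf par).neighborSet v).ncard = if (v : ℕ) < g then 1 else 3) ↔
      Cub g r par := by
  constructor
  · intro h
    refine ⟨hr, hp, ?_, ?_, ?_⟩
    · intro v hv c hc hcv
      have h1 := h v
      have hvr : v ≠ r := by rintro rfl; omega
      rw [hp.ncard_nbr, if_neg hvr, if_pos (by omega)] at h1
      have h2 : {c | c ≠ r ∧ par c = v}.ncard = 0 := by omega
      rw [Set.ncard_eq_zero (Set.toFinite _)] at h2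
      have : c ∈ {c | c ≠ r ∧ par c = v} := ⟨hc, hcv⟩
      rw [h2] at this
      exact this
    · have h1 := h r
      rw [hp.ncard_nbr, if_pos rfl, if_pos (by omega)] at h1
      obtain ⟨c, hc⟩ := Set.ncard_eq_one.mp h1
      have h2 : ∀ d, (d ≠ r ∧ par d = r) ↔ d = c := by
        intro d
        have : d ∈ {c | c ≠ r ∧ par c = r} ↔ d ∈ ({c} : Set _) := by rw [hc]
        simpa using this
      exact ⟨c, ((h2 c).mpr rfl).1, ((h2 c).mpr rfl).2, fun d h3 h4 => (h2 d).mp ⟨h3, h4⟩⟩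
    · intro v hv
      have h1 := h v
      have hvr : v ≠ r := by rintro rfl; omega
      rw [hp.ncard_nbr, if_neg hvr, if_neg (by omega)] at h1
      obtain ⟨c, d, hcd, hs⟩ := Set.ncard_eq_two.mp (show {c | c ≠ r ∧ par c = v}.ncard = 2 by omega)
      have h2 : ∀ e, (e ≠ r ∧ par e = v) ↔ e = c ∨ e = d := by
        intro e
        have : e ∈ {c | c ≠ r ∧ par c = v} ↔ e ∈ ({c, d} : Set _) := by rw [hs]
        simpa using this
      have hc := (h2 c).mpr (Or.inl rfl)
      have hd := (h2 d).mpr (Or.inr rfl)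
      exact ⟨c, d, hcd, hc.1, hd.1, hc.2, hd.2, fun e h3 h4 => (h2 e).mp ⟨h3, h4⟩⟩
  · intro h v
    rw [hp.ncard_nbr]
    rcases lt_trichotomy (v : ℕ) (g - 1) with hv | hv | hv
    · have hvr : v ≠ r := by rintro rfl; omega
      rw [if_neg hvr, if_pos (by omega)]
      have : {c | c ≠ r ∧ par c = v} = ∅ := by
        ext c
        simp only [Set.mem_ofPred_eq, Set.mem_empty_iff_false, iff_false, not_and]
        exact h.leaf v hv c
      rw [this]; simp
    · have hvr : v = r := Fin.ext (by omega)
      rw [if_pos hvr, if_pos (by omega)]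
      obtain ⟨c, h1, h2, h3⟩ := h.rootc
      have : {c | c ≠ r ∧ par c = v} = {c} := by
        ext d
        simp only [Set.mem_ofPred_eq, Set.mem_singleton_iff]
        rw [hvr]
        exact ⟨fun h => h3 d h.1 h.2, by rintro rfl; exact ⟨h1, h2⟩⟩
      rw [this]; simp
    · have hvr : v ≠ r := by rintro rfl; omega
      rw [if_neg hvr, if_neg (by omega)]
      obtain ⟨c, d, hcd, h1, h2, h3, h4, h5⟩ := h.intc v (by omega)
      have : {c | c ≠ r ∧ par c = v} = {c, d} := by
        ext e
        simp only [Set.mem_ofPred_eq, Set.mem_singleton_iff, Set.mem_insert_iff]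
        refine ⟨fun h => h5 e h.1 h.2, ?_⟩
        rintro (rfl | rfl)
        · exact ⟨h1, h3⟩
        · exact ⟨h2, h4⟩
      rw [this, Set.ncard_pair hcd]

open Classical in
noncomputable def dset (g : ℕ) (par : Fin (2 * g - 2) → Fin (2 * g - 2)) (v : Fin (2 * g - 2)) :
    Finset ℕ :=
  (Finset.univ.filter (fun l : Fin (2 * g - 2) => (l : ℕ) < g - 1 ∧ Anc par v l)).image
    (fun l => (l : ℕ) + 1)

variable {g : ℕ} {r : Fin (2 * g - 2)} {par : Fin (2 * g - 2) → Fin (2 * g - 2)}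

lemma mem_dset {v : Fin (2 * g - 2)} {m : ℕ} :
    m ∈ dset g par v ↔ ∃ l : Fin (2 * g - 2), (l : ℕ) < g - 1 ∧ Anc par v l ∧ (l : ℕ) + 1 = m := by
  simp [dset, and_assoc]

lemma mem_dset' {v l : Fin (2 * g - 2)} (hl : (l : ℕ) < g - 1) :
    (l : ℕ) + 1 ∈ dset g par v ↔ Anc par v l := by
  rw [mem_dset]
  constructor
  · rintro ⟨l', h1, h2, h3⟩
    have : l' = l := Fin.ext (by omega)
    rwa [this] at h2
  · intro h; exact ⟨l, hl, h, rfl⟩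

lemma Cub.leaf_anc (h : Cub g r par) {v x : Fin (2 * g - 2)} (hv : (v : ℕ) < g - 1)
    (ha : Anc par v x) : x = v := by
  by_contra hne
  obtain ⟨c, h1, h2, -⟩ := h.isPar.child ha hne
  exact h.leaf v hv c h2 h1

lemma Cub.exists_leaf (hg : 3 ≤ g) (h : Cub g r par) (v : Fin (2 * g - 2)) :
    ∃ l : Fin (2 * g - 2), (l : ℕ) < g - 1 ∧ Anc par v l := by
  by_cases hvr : v = r
  · exact ⟨⟨0, by omega⟩, by simp; omega, hvr ▸ h.isPar.anc_root _⟩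
  obtain ⟨x, hx, hmin⟩ := Set.exists_min_image {x | Anc par v x} (fun x => {y | Anc par x y}.ncard)
    (Set.toFinite _) ⟨v, Anc.refl _ _⟩
  have hx' : Anc par v x := hx
  refine ⟨x, ?_, hx'⟩
  by_contra hlt
  have hxr : x ≠ r := by
    rintro rfl
    exact hvr (h.isPar.eq_root hx')
  have hxg : g ≤ (x : ℕ) := by
    have : (x : ℕ) ≠ r := fun h => hxr (Fin.ext h)
    have := h.rv
    omega
  obtain ⟨c, d, -, hc, -, hcx, -⟩ := h.intc x hxg
  have hxc : Anc par x c := ⟨1, hcx⟩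
  have h1 := hmin c (hx'.trans hxc)
  have h2 : {y | Anc par c y} ⊂ {y | Anc par x y} := by
    refine (Set.ssubset_iff_of_subset (fun y hy => hxc.trans hy)).mpr ⟨x, Anc.refl _ _, ?_⟩
    intro h3
    have h3' : Anc par c x := h3
    rw [← hcx] at h3'
    exact h.isPar.not_anc_par hc h3'
  have := Set.ncard_lt_ncard h2 (Set.toFinite _)
  omega

lemma dset_mono {u v : Fin (2 * g - 2)} (ha : Anc par v u) : dset g par u ⊆ dset g par v := by
  intro m hm
  rw [mem_dset] at *
  obtain ⟨l, h1, h2, h3⟩ := hm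
  exact ⟨l, h1, ha.trans h2, h3⟩

lemma Cub.strict (hg : 3 ≤ g) (h : Cub g r par) {u v : Fin (2 * g - 2)} (ha : Anc par v u)
    (hne : u ≠ v) (hv : v ≠ r) : dset g par u ⊂ dset g par v := by
  refine (Finset.ssubset_iff_of_subset (dset_mono ha)).mpr ?_
  have hvg : g ≤ (v : ℕ) := by
    have h1 : (v : ℕ) ≠ r := fun h => hv (Fin.ext h)
    have := h.rv
    by_contra h2
    exact hne (h.leaf_anc (by omega) ha)
  obtain ⟨c, hc1, hc2, hc3⟩ := h.isPar.child ha hne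
  have : ∃ d, d ≠ c ∧ d ≠ r ∧ par d = v := by
    obtain ⟨a, b, hab, ha1, hb1, ha2, hb2, -⟩ := h.intc v hvg
    by_cases hac : a = c
    · exact ⟨b, fun h => hab (hac.trans h.symm), hb1, hb2⟩
    · exact ⟨a, hac, ha1, ha2⟩
  obtain ⟨d, hdc, hdr, hdv⟩ := this
  obtain ⟨l, hl, hdl⟩ := h.exists_leaf hg d
  refine ⟨(l : ℕ) + 1, (mem_dset' hl).mpr ((show Anc par v d from ⟨1, hdv⟩).trans hdl), ?_⟩
  rw [mem_dset' hl]
  intro hul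
  exact hdc (h.isPar.sibling hdr hc2 (hdv.trans hc1.symm) hdl (hc3.trans hul))

lemma Cub.anc_iff_dset (hg : 3 ≤ g) (h : Cub g r par) {u v : Fin (2 * g - 2)} (hu : u ≠ r) :
    Anc par v u ↔ dset g par u ⊆ dset g par v := by
  refine ⟨dset_mono, fun hs => ?_⟩
  obtain ⟨l, hl, hul⟩ := h.exists_leaf hg u
  have hvl := (mem_dset' hl).mp (hs ((mem_dset' hl).mpr hul))
  rcases hvl.total hul with h1 | h1
  · exact h1
  · by_cases huv : v = u
    · rw [huv]; exact Anc.refl _ _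
    · exact ((h.strict hg h1 huv hu).2 hs).elim

lemma Cub.dset_leaf (h : Cub g r par) {v : Fin (2 * g - 2)} (hv : (v : ℕ) < g - 1) :
    dset g par v = {(v : ℕ) + 1} := by
  ext m
  rw [mem_dset, Finset.mem_singleton]
  constructor
  · rintro ⟨l, h1, h2, h3⟩
    rw [← h3, h.leaf_anc hv h2]
  · intro hm; exact ⟨v, hv, Anc.refl _ _, hm.symm⟩

lemma Cub.dset_two (hg : 3 ≤ g) (h : Cub g r par) {v : Fin (2 * g - 2)} (hv : g ≤ (v : ℕ)) :
    2 ≤ (dset g par v).card := by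
  obtain ⟨a, b, hab, ha1, hb1, ha2, hb2, -⟩ := h.intc v hv
  obtain ⟨l, hl, hal⟩ := h.exists_leaf hg a
  obtain ⟨m, hm, hbm⟩ := h.exists_leaf hg b
  refine Finset.one_lt_card.mpr ⟨(l : ℕ) + 1, ?_, (m : ℕ) + 1, ?_, ?_⟩
  · exact (mem_dset' hl).mpr ((show Anc par v a from ⟨1, ha2⟩).trans hal)
  · exact (mem_dset' hm).mpr ((show Anc par v b from ⟨1, hb2⟩).trans hbm)
  · intro hlm
    have : l = m := Fin.ext (by omega)
    subst this
    exact hab (h.isPar.sibling ha1 hb1 (ha2.trans hb2.symm) hal hbm)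

def intv (g : ℕ) (i : Fin (g - 2)) : Fin (2 * g - 2) := ⟨g + i, by omega⟩

lemma intv_ge (i : Fin (g - 2)) : g ≤ (intv g i : ℕ) := by simp [intv]

lemma exists_intv {v : Fin (2 * g - 2)} (hv : g ≤ (v : ℕ)) : ∃ i, intv g i = v :=
  ⟨⟨(v : ℕ) - g, by omega⟩, Fin.ext (by simp [intv]; omega)⟩

lemma intv_inj : Function.Injective (intv g) := by
  intro i j h
  have := Fin.ext_iff.mp h
  simp [intv] at this
  exact Fin.ext this

noncomputable def sfun (g : ℕ) (par : Fin (2 * g - 2) → Fin (2 * g - 2)) (i : Fin (g - 2)) :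
    Finset ℕ := dset g par (intv g i)

lemma Cub.ne_root (h : Cub g r par) (hg : 3 ≤ g) {v : Fin (2 * g - 2)} (hv : g ≤ (v : ℕ)) : v ≠ r := by
  rintro rfl
  have := h.rv
  omega

lemma Cub.sfun_inj (hg : 3 ≤ g) (h : Cub g r par) : Function.Injective (sfun g par) := by
  intro i j hij
  apply intv_inj
  have hi := h.ne_root hg (intv_ge i)
  have hj := h.ne_root hg (intv_ge j)
  exact h.isPar.antisymm ((h.anc_iff_dset hg hj).mpr hij.symm.subset)
    ((h.anc_iff_dset hg hi).mpr hij.subset)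

lemma mem_fam {A : Finset ℕ} : A ∈ Finset.univ.image (sfun g par) ↔
    ∃ v : Fin (2 * g - 2), g ≤ (v : ℕ) ∧ dset g par v = A := by
  simp only [Finset.mem_image, Finset.mem_univ, true_and, sfun]
  constructor
  · rintro ⟨i, hi⟩; exact ⟨_, intv_ge i, hi⟩
  · rintro ⟨v, hv, h⟩
    obtain ⟨i, rfl⟩ := exists_intv hv
    exact ⟨i, h⟩

lemma Cub.hier (hg : 3 ≤ g) (h : Cub g r par) : IsHier g (Finset.univ.image (sfun g par)) := by
  have hsub : ∀ v, dset g par v ⊆ Finset.Icc 1 (g - 1) := by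
    intro v m hm
    rw [mem_dset] at hm
    obtain ⟨l, h1, h2, h3⟩ := hm
    rw [Finset.mem_Icc]; omega
  refine ⟨?_, ?_, ?_, ?_, ?_⟩
  · intro A hA
    obtain ⟨v, hv, rfl⟩ := mem_fam.mp hA
    exact hsub v
  · intro A hA
    obtain ⟨v, hv, rfl⟩ := mem_fam.mp hA
    exact h.dset_two hg hv
  · rw [mem_fam]
    obtain ⟨c, hcr, hc, huniq⟩ := h.rootc
    have hall : ∀ x, x ≠ r → Anc par c x := by
      intro x hx
      obtain ⟨d, h1, h2, h3⟩ := h.isPar.child (h.isPar.anc_root x) hx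
      rwa [huniq d h2 h1] at h3
    have hrv := h.rv
    refine ⟨c, ?_, Finset.Subset.antisymm (hsub c) ?_⟩
    · by_contra hlt
      have h1 : (c : ℕ) ≠ r := fun h => hcr (Fin.ext h)
      have h2 := h.leaf_anc (v := c) (x := ⟨0, by omega⟩) (by omega)
        (hall _ (fun h => by have := Fin.ext_iff.mp h; simp at this; omega))
      have h3 := h.leaf_anc (v := c) (x := ⟨1, by omega⟩) (by omega)
        (hall _ (fun h => by have := Fin.ext_iff.mp h; simp at this; omega))
      have h4 := Fin.ext_iff.mp (h2.trans h3.symm)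
      simp at h4
    · intro m hm
      rw [Finset.mem_Icc] at hm
      rw [mem_dset]
      refine ⟨⟨m - 1, by omega⟩, by simp; omega, hall _ ?_, by simp; omega⟩
      intro h; have := Fin.ext_iff.mp h; simp at this; omega
  · intro A hA B hB
    obtain ⟨u, hu, rfl⟩ := mem_fam.mp hA
    obtain ⟨v, hv, rfl⟩ := mem_fam.mp hB
    by_cases hd : Disjoint (dset g par u) (dset g par v)
    · exact Or.inr (Or.inr hd)
    · rw [Finset.not_disjoint_iff] at hd
      obtain ⟨m, hm1, hm2⟩ := hd
      obtain ⟨l, hl, h1, rfl⟩ := mem_dset.mp hm1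
      rw [mem_dset' hl] at hm2
      rcases h1.total hm2 with h | h
      · exact Or.inr (Or.inl (dset_mono h))
      · exact Or.inl (dset_mono h)
  · rw [Finset.card_image_of_injective _ (h.sfun_inj hg)]; simp

lemma Cub.bal_iff (hg : 3 ≤ g) (h : Cub g r par) : BalancedFam (Finset.univ.image (sfun g par)) ↔
    ∀ v : Fin (2 * g - 2), g ≤ (v : ℕ) → BalancedAt g (graphOf par) r v := by
  constructor
  · intro hb v hv l₁ l₂ hl1 hl2 h1 h2 hlt hmin
    rw [h.isPar.descLeaf] at h1 h2
    rw [h.isPar.edges_disj h1 h2]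
    rintro ⟨y, hyv, hy, hy1, hy2⟩
    have hyg : g ≤ (y : ℕ) := by
      by_contra hyg
      have : y ≠ r := by
        rintro rfl
        exact hyv (h.isPar.eq_root hy).symm
      have h1 : (y : ℕ) ≠ r := fun h => this (Fin.ext h)
      have h2 := h.rv
      have h3 := h.leaf_anc (v := y) (by omega) hy1
      have h4 := h.leaf_anc (v := y) (by omega) hy2
      rw [h3, h4] at hlt
      exact lt_irrefl _ hlt
    refine hb (dset g par v) (mem_fam.mpr ⟨v, hv, rfl⟩) (l₁ + 1) (l₂ + 1) ((mem_dset' hl1).mpr h1)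
      ((mem_dset' hl2).mpr h2) (by have := Fin.lt_def.mp hlt; omega) ?_
      ⟨dset g par y, mem_fam.mpr ⟨y, hyg, rfl⟩, h.strict hg hy hyv (h.ne_root hg hv),
        (mem_dset' hl1).mpr hy1, (mem_dset' hl2).mpr hy2⟩
    intro m hm
    obtain ⟨l, hl, hvl, rfl⟩ := mem_dset.mp hm
    rcases hmin l hl (h.isPar.descLeaf.mpr hvl) with h | h
    · left; rw [h]
    · right; have := Fin.le_def.mp h; omega
  · rintro hb A hA m₁ m₂ h1 h2 hlt hmin ⟨B, hB, hBA, hB1, hB2⟩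
    obtain ⟨v, hv, rfl⟩ := mem_fam.mp hA
    obtain ⟨y, hyg, rfl⟩ := mem_fam.mp hB
    obtain ⟨l₁, hl1, h1', rfl⟩ := mem_dset.mp h1
    obtain ⟨l₂, hl2, h2', rfl⟩ := mem_dset.mp h2
    clear h1 h2
    rename' h1' => h1, h2' => h2
    have key := hb v hv l₁ l₂ hl1 hl2 (h.isPar.descLeaf.mpr h1) (h.isPar.descLeaf.mpr h2)
      (Fin.lt_def.mpr (by omega)) ?_
    · rw [h.isPar.edges_disj h1 h2] at key
      refine key ⟨y, ?_, (h.anc_iff_dset hg (h.ne_root hg hyg)).mpr hBA.1,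
        (mem_dset' hl1).mp hB1, (mem_dset' hl2).mp hB2⟩
      rintro rfl
      exact hBA.2 (Finset.Subset.refl _)
    · intro l hl hvl
      rw [h.isPar.descLeaf] at hvl
      rcases hmin _ ((mem_dset' hl).mpr hvl) with h | h
      · left; exact Fin.ext (by omega)
      · right; exact Fin.le_def.mpr (by omega)

lemma Cub.unique (hg : 3 ≤ g) {par' : Fin (2 * g - 2) → Fin (2 * g - 2)} (h : Cub g r par)
    (h' : Cub g r par') (hs : sfun g par = sfun g par') : par = par' := by
  have hd : ∀ v, v ≠ r → dset g par v = dset g par' v := by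
    intro v hv
    have h1 : (v : ℕ) ≠ r := fun h => hv (Fin.ext h)
    have h2 := h.rv
    by_cases hvg : g ≤ (v : ℕ)
    · obtain ⟨i, rfl⟩ := exists_intv hvg
      exact congrFun hs i
    · rw [h.dset_leaf (by omega), h'.dset_leaf (by omega)]
  have ha : ∀ u v, Anc par v u ↔ Anc par' v u := by
    intro u v
    by_cases hv : v = r
    · rw [hv]; exact ⟨fun _ => h'.isPar.anc_root u, fun _ => h.isPar.anc_root u⟩
    · by_cases hu : u = r
      · rw [hu]
        exact ⟨fun h1 => (hv (h.isPar.eq_root h1)).elim, fun h1 => (hv (h'.isPar.eq_root h1)).elim⟩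
      · rw [h.anc_iff_dset hg hu, h'.anc_iff_dset hg hu, hd u hu, hd v hv]
  funext v
  by_cases hv : v = r
  · rw [hv, h.isPar.root, h'.isPar.root]
  · have h1 : Anc par' (par v) (par' v) := by
      rcases anc_iff.mp ((ha _ _).mp (Anc.par par v)) with h1 | h1
      · exact (h.isPar.par_ne hv h1.symm).elim
      · exact h1
    have h2 : Anc par (par' v) (par v) := by
      rcases anc_iff.mp ((ha _ _).mpr (Anc.par par' v)) with h1 | h1
      · exact (h'.isPar.par_ne hv h1.symm).elim
      · exact h1
    exact h'.isPar.antisymm h1 ((ha _ _).mp h2)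

end Part4
section Part5

lemma exists_par_of_lam {V : Type*} [Finite V] (r : V) (N : V → Finset ℕ)
    (hinj : Function.Injective N) (hne : ∀ v, (N v).Nonempty)
    (hlam : ∀ u v, N u ⊆ N v ∨ N v ⊆ N u ∨ Disjoint (N u) (N v)) (htop : ∀ v, N v ⊆ N r) :
    ∃ par, IsPar r par ∧ (∀ u v, Anc par v u ↔ N u ⊆ N v) ∧
      (∀ v, v ≠ r → N v ⊂ N (par v) ∧ ∀ u, N v ⊂ N u → N (par v) ⊆ N u) := by
  classical
  have hex : ∀ v, ∃ w, v ≠ r → N v ⊂ N w ∧ ∀ u, N v ⊂ N u → N w ⊆ N u := by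
    intro v
    by_cases hv : v = r
    · exact ⟨r, fun h => (h hv).elim⟩
    obtain ⟨w, hw, hmin⟩ := Set.exists_min_image {u | N v ⊂ N u} (fun u => (N u).card)
      (Set.toFinite _) ⟨r, (htop v).ssubset_of_ne (fun h => hv (hinj h))⟩
    have hw' : N v ⊂ N w := hw
    refine ⟨w, fun _ => ⟨hw', fun u hu => ?_⟩⟩
    rcases hlam w u with h | h | h
    · exact h
    · exact (Finset.eq_of_subset_of_card_le h (hmin u hu)).symm.subset
    · obtain ⟨x, hx⟩ := hne v
      exact (Finset.disjoint_left.mp h (hw'.1 hx) (hu.1 hx)).elim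
  choose f hf using hex
  let par : V → V := fun v => if v = r then r else f v
  have hpar : ∀ v, v ≠ r → par v = f v := fun v hv => by simp [par, hv]
  have hroot : par r = r := by simp [par]
  have hspec : ∀ v, v ≠ r → N v ⊂ N (par v) ∧ ∀ u, N v ⊂ N u → N (par v) ⊆ N u := by
    intro v hv; rw [hpar v hv]; exact hf v hv
  have hanc : ∀ n u v, (N r).card - (N u).card = n → N u ⊆ N v → Anc par v u := by
    intro n
    induction n using Nat.strong_induction_on with
    | _ n ih =>
      intro u v hn huv
      by_cases he : u = v
      · rw [he]; exact Anc.refl _ _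
      · have hss : N u ⊂ N v := huv.ssubset_of_ne (fun h => he (hinj h))
        have hu : u ≠ r := by
          rintro rfl
          exact hss.2 (htop v)
        obtain ⟨h1, h2⟩ := hspec u hu
        have h3 := Finset.card_lt_card h1
        have h4 := Finset.card_le_card (htop (par u))
        exact (ih _ (by omega) (par u) v rfl (h2 v hss)).trans (Anc.par _ _)
  refine ⟨par, ⟨hroot, fun v => hanc _ v r rfl (htop v)⟩, ?_, hspec⟩
  intro u v
  refine ⟨?_, hanc _ u v rfl⟩
  rintro ⟨k, hk⟩
  induction k generalizing u with
  | zero =>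
    have : u = v := hk
    rw [this]
  | succ k ih =>
    rw [Function.iterate_succ_apply] at hk
    refine Finset.Subset.trans ?_ (ih (par u) hk)
    by_cases hu : u = r
    · rw [hu, hroot]
    · exact (hspec u hu).1.1

lemma cub_surj {g : ℕ} (hg : 3 ≤ g) {r : Fin (2 * g - 2)} (hr : (r : ℕ) = g - 1)
    (S : Fin (g - 2) → Finset ℕ) (hS : Function.Injective S)
    (hF : IsHier g (Finset.univ.image S)) : ∃ par, Cub g r par ∧ sfun g par = S := by
  classical
  have hF' := hF
  obtain ⟨hU, h2F, hfull, hlamF, -⟩ := hF'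
  have hmem : ∀ i, S i ∈ Finset.univ.image S := fun i => by simp
  let N : Fin (2 * g - 2) → Finset ℕ := fun v =>
    if h : g ≤ (v : ℕ) then S ⟨(v : ℕ) - g, by omega⟩
    else if (v : ℕ) < g - 1 then {(v : ℕ) + 1} else Finset.range g
  have hNleaf : ∀ v : Fin (2 * g - 2), (v : ℕ) < g - 1 → N v = {(v : ℕ) + 1} := by
    intro v hv
    simp only [N]
    rw [dif_neg (by omega), if_pos hv]
  have hNroot : N r = Finset.range g := by
    simp only [N]
    rw [dif_neg (by omega), if_neg (by omega)]
  have hNint : ∀ i, N (intv g i) = S i := by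
    intro i
    simp only [N]
    rw [dif_pos (intv_ge i)]
    congr 1
    apply Fin.ext
    simp [intv]
  have hcases : ∀ v : Fin (2 * g - 2), (v : ℕ) < g - 1 ∨ v = r ∨ ∃ i, intv g i = v := by
    intro v
    rcases lt_trichotomy (v : ℕ) (g - 1) with h | h | h
    · exact Or.inl h
    · exact Or.inr (Or.inl (Fin.ext (by omega)))
    · exact Or.inr (Or.inr (exists_intv (by omega)))
  have hgood : ∀ v, v ≠ r → N v ∈ Finset.univ.image S ∨ (N v).card = 1 := by
    intro v hv
    rcases hcases v with h | h | ⟨i, rfl⟩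
    · right; rw [hNleaf v h]; simp
    · exact (hv h).elim
    · left; rw [hNint]; exact hmem i
  have hsubI : ∀ v, v ≠ r → N v ⊆ Finset.Icc 1 (g - 1) := by
    intro v hv
    rcases hcases v with h | h | ⟨i, rfl⟩
    · rw [hNleaf v h]; intro x; simp; omega
    · exact (hv h).elim
    · rw [hNint]; exact hU _ (hmem i)
  have hIr : Finset.Icc 1 (g - 1) ⊂ N r := by
    rw [hNroot]
    refine (Finset.ssubset_iff_of_subset ?_).mpr ⟨0, by simp; omega, by simp⟩
    intro x; simp; omega
  have htop : ∀ v, N v ⊆ N r := by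
    intro v
    by_cases hv : v = r
    · rw [hv]
    · exact (hsubI v hv).trans hIr.1
  have hsurj : ∀ A, A ⊆ Finset.Icc 1 (g - 1) → (A ∈ Finset.univ.image S ∨ A.card = 1) →
      ∃ v, v ≠ r ∧ N v = A := by
    rintro A hAI (hA | hA)
    · simp only [Finset.mem_image, Finset.mem_univ, true_and] at hA
      obtain ⟨i, rfl⟩ := hA
      refine ⟨intv g i, ?_, hNint i⟩
      rintro h
      have := intv_ge i
      rw [h] at this; omega
    · obtain ⟨x, rfl⟩ := Finset.card_eq_one.mp hA
      have hx := hAI (Finset.mem_singleton_self x)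
      rw [Finset.mem_Icc] at hx
      refine ⟨⟨x - 1, by omega⟩, ?_, ?_⟩
      · intro h; have := Fin.ext_iff.mp h; simp at this; omega
      · rw [hNleaf _ (by simp; omega)]
        simp; omega
  have hne : ∀ v, (N v).Nonempty := by
    intro v
    by_cases hv : v = r
    · rw [hv, hNroot]; exact ⟨0, by simp; omega⟩
    · apply Finset.card_pos.mp
      rcases hgood v hv with h | h
      · have := h2F _ h; omega
      · omega
  have hinj : Function.Injective N := by
    intro u v huv
    rcases hcases u with hu | hu | ⟨i, rfl⟩ <;> rcases hcases v with hv | hv | ⟨j, rfl⟩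
    · rw [hNleaf u hu, hNleaf v hv] at huv
      simp at huv
      exact Fin.ext huv
    · have h1 := hsubI u (by rintro rfl; omega)
      rw [huv, hv] at h1
      exact (hIr.2 h1).elim
    · have h1 := h2F _ (hmem j)
      rw [← hNint, ← huv, hNleaf u hu] at h1
      simp at h1
    · have h1 := hsubI v (by rintro rfl; omega)
      rw [← huv, hu] at h1
      exact (hIr.2 h1).elim
    · rw [hu, hv]
    · have h1 := hU _ (hmem j)
      rw [← hNint, ← huv, hu] at h1
      exact (hIr.2 h1).elim
    · have h1 := h2F _ (hmem i)
      rw [← hNint, huv, hNleaf v hv] at h1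
      simp at h1
    · have h1 := hU _ (hmem i)
      rw [← hNint, huv, hv] at h1
      exact (hIr.2 h1).elim
    · rw [hNint, hNint] at huv
      rw [hS huv]
  have hlam : ∀ u v, N u ⊆ N v ∨ N v ⊆ N u ∨ Disjoint (N u) (N v) := by
    intro u v
    by_cases hu : u = r
    · right; left; rw [hu]; exact htop v
    by_cases hv : v = r
    · left; rw [hv]; exact htop u
    rcases hgood u hu with h1 | h1
    · rcases hgood v hv with h2 | h2
      · exact hlamF _ h1 _ h2
      · obtain ⟨x, hx⟩ := Finset.card_eq_one.mp h2
        rw [hx]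
        by_cases hxu : x ∈ N u
        · right; left; simpa using hxu
        · right; right; simpa using hxu
    · obtain ⟨x, hx⟩ := Finset.card_eq_one.mp h1
      rw [hx]
      by_cases hxu : x ∈ N v
      · left; simpa using hxu
      · right; right; simpa using hxu
  obtain ⟨par, hP, hanc, hspec⟩ := exists_par_of_lam r N hinj hne hlam htop
  refine ⟨par, ⟨hr, hP, ?_, ?_, ?_⟩, ?_⟩
  · intro v hv c hc hcv
    have h1 := (hspec c hc).1
    rw [hcv, hNleaf v hv] at h1
    have h2 := Finset.card_lt_card h1
    have h3 := (hne c).card_pos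
    simp at h2
    exact (hne c).ne_empty h2
  · obtain ⟨c, hc, hNc⟩ := hsurj _ (Finset.Subset.refl _) (Or.inl hfull)
    refine ⟨c, hc, ?_, ?_⟩
    · by_contra h
      have h1 := (hspec c hc).1
      rw [hNc] at h1
      exact h1.2 (hsubI _ h)
    · intro d hd hdr
      by_contra hdc
      have h1 : N d ⊂ N c := by
        refine Finset.ssubset_iff_subset_ne.mpr ⟨?_, fun h => hdc (hinj h)⟩
        rw [hNc]; exact hsubI d hd
      have h2 := (hspec d hd).2 c h1
      rw [hdr, hNc] at h2
      exact hIr.2 h2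
  · intro v hv
    obtain ⟨i, rfl⟩ := exists_intv hv
    obtain ⟨X, Y, hXY, hun, hX0, hY0, hX, hY, hcl⟩ := hier_split hF (hmem i)
    rw [← hNint] at hun hcl
    set v := intv g i with hvdef
    have hvr : v ≠ r := by rintro rfl; omega
    have hXs : X ⊆ N v := by rw [← hun]; exact Finset.subset_union_left
    have hYs : Y ⊆ N v := by rw [← hun]; exact Finset.subset_union_right
    obtain ⟨c, hc, rfl⟩ := hsurj X (hXs.trans (hsubI v hvr)) hX
    obtain ⟨d, hd, rfl⟩ := hsurj Y (hYs.trans (hsubI v hvr)) hY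
    have hnsub : ∀ a b, Disjoint (N a) (N b) → ¬ N a ⊆ N b := by
      intro a b hab hs
      obtain ⟨x, hx⟩ := hne a
      exact Finset.disjoint_left.mp hab hx (hs hx)
    have hcv : N c ⊂ N v := by
      refine ⟨hXs, fun h => ?_⟩
      exact hnsub d c hXY.symm (hYs.trans h)
    have hdv : N d ⊂ N v := by
      refine ⟨hYs, fun h => ?_⟩
      exact hnsub c d hXY (hXs.trans h)
    have hparv : ∀ a b, a ≠ r → N a ⊂ N v → Disjoint (N a) (N b) →
        (∀ B, (B ∈ Finset.univ.image S ∨ B.card = 1) → B ⊂ N v → B ⊆ N a ∨ B ⊆ N b) →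
        par a = v := by
      intro a b ha hav hab hcl
      obtain ⟨h1, h2⟩ := hspec a ha
      have h3 := h2 v hav
      by_contra hne'
      have h4 : N (par a) ⊂ N v := h3.ssubset_of_ne (fun h => hne' (hinj h))
      have h5 : par a ≠ r := by
        intro h; rw [h] at h4; exact h4.2 (htop v)
      rcases hcl _ (hgood _ h5) h4 with h | h
      · exact h1.2 h
      · exact hnsub a b hab (h1.1.trans h)
    refine ⟨c, d, ?_, hc, hd, hparv c d hc hcv hXY hcl, hparv d c hd hdv hXY.symm
      (fun B h1 h2 => (hcl B h1 h2).symm), ?_⟩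
    · rintro rfl
      exact hnsub c c hXY (Finset.Subset.refl _)
    · intro e he hev
      obtain ⟨h1, h2⟩ := hspec e he
      rw [hev] at h1 h2
      rcases hcl _ (hgood e he) h1 with h | h
      · left
        by_contra hne'
        exact hcv.2 (h2 c (h.ssubset_of_ne (fun h => hne' (hinj h))))
      · right
        by_contra hne'
        exact hdv.2 (h2 d (h.ssubset_of_ne (fun h => hne' (hinj h))))
  · funext i
    ext m
    rw [sfun, mem_dset]
    constructor
    · rintro ⟨l, h1, h2, rfl⟩
      rw [hanc, hNint, hNleaf l h1] at h2
      simpa using h2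
    · intro hm
      have h1 := hU _ (hmem i) hm
      rw [Finset.mem_Icc] at h1
      refine ⟨⟨m - 1, by omega⟩, by simp; omega, ?_, by simp; omega⟩
      rw [hanc, hNint, hNleaf _ (by simp; omega)]
      rw [Finset.singleton_subset_iff]
      have : m - 1 + 1 = m := by omega
      simpa [this] using hm

lemma sfun_count (g : ℕ) (hg : 3 ≤ g) :
    Nat.card {S : Fin (g - 2) → Finset ℕ // Function.Injective S ∧ IsHier g (Finset.univ.image S) ∧
      BalancedFam (Finset.univ.image S)} = Nat.factorial (g - 2) * Nat.factorial (g - 2) := by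
  classical
  let H := {F : Finset (Finset ℕ) // IsHier g F ∧ BalancedFam F}
  let e : ∀ F : H, Fin (g - 2) ≃ F.1 := fun F => (F.1.equivFinOfCardEq F.2.1.2.2.2.2).symm
  have him : ∀ (F : H) (σ : Equiv.Perm (Fin (g - 2))),
      Finset.univ.image (fun i => ((e F (σ i)) : Finset ℕ)) = F.1 := by
    intro F σ
    ext A
    simp only [Finset.mem_image, Finset.mem_univ, true_and]
    constructor
    · rintro ⟨i, rfl⟩; exact (e F (σ i)).2
    · intro hA
      exact ⟨σ.symm ((e F).symm ⟨A, hA⟩), by simp⟩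
  let f : H × Equiv.Perm (Fin (g - 2)) → {S : Fin (g - 2) → Finset ℕ // Function.Injective S ∧
      IsHier g (Finset.univ.image S) ∧ BalancedFam (Finset.univ.image S)} :=
    fun x => ⟨fun i => (e x.1 (x.2 i)).1, fun i j h => x.2.injective ((e x.1).injective
      (Subtype.ext h)), by rw [him]; exact x.1.2⟩
  have hf : Function.Bijective f := by
    constructor
    · rintro ⟨F, σ⟩ ⟨F', σ'⟩ h
      have h1 : (fun i => ((e F (σ i)) : Finset ℕ)) = fun i => ((e F' (σ' i)) : Finset ℕ) :=
        Subtype.ext_iff.mp h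
      have h2 : F = F' := Subtype.ext (by rw [← him F σ, h1, him])
      subst h2
      have : σ = σ' := by
        ext i : 1
        exact (e F).injective (Subtype.ext (congrFun h1 i))
      rw [this]
    · rintro ⟨S, hS, hF⟩
      let F : H := ⟨_, hF⟩
      let s : Fin (g - 2) → Fin (g - 2) := fun i => (e F).symm ⟨S i, by simp [F]⟩
      have hs : Function.Injective s := by
        intro i j hij
        have := (e F).symm.injective hij
        exact hS (Subtype.ext_iff.mp this)
      refine ⟨⟨F, Equiv.ofBijective s (Finite.injective_iff_bijective.mp hs)⟩, ?_⟩
      apply Subtype.ext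
      funext i
      simp [f, s]
  rw [← Nat.card_congr (Equiv.ofBijective f hf), Nat.card_prod, Nat.card_perm, hier_count g hg]
  simp

lemma graph_count (g : ℕ) (hg : 3 ≤ g) (r : Fin (2 * g - 2)) (hr : (r : ℕ) = g - 1) :
    Nat.card {G : SimpleGraph (Fin (2 * g - 2)) // G.IsTree ∧
        (∀ v : Fin (2 * g - 2), (G.neighborSet v).ncard = if (v : ℕ) < g then 1 else 3) ∧
        (∀ v : Fin (2 * g - 2), g ≤ (v : ℕ) → BalancedAt g G r v)} =
      Nat.factorial (g - 2) * Nat.factorial (g - 2) := by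
  rw [← sfun_count g hg]
  symm
  choose P hP1 hP2 using fun (S : {S : Fin (g - 2) → Finset ℕ // Function.Injective S ∧
    IsHier g (Finset.univ.image S) ∧ BalancedFam (Finset.univ.image S)}) =>
    cub_surj hg hr S.1 S.2.1 S.2.2.1
  let f : {S : Fin (g - 2) → Finset ℕ // Function.Injective S ∧
      IsHier g (Finset.univ.image S) ∧ BalancedFam (Finset.univ.image S)} →
      {G : SimpleGraph (Fin (2 * g - 2)) // G.IsTree ∧
        (∀ v : Fin (2 * g - 2), (G.neighborSet v).ncard = if (v : ℕ) < g then 1 else 3) ∧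
        (∀ v : Fin (2 * g - 2), g ≤ (v : ℕ) → BalancedAt g G r v)} :=
    fun S => ⟨graphOf (P S), (hP1 S).isPar.isTree, (cub_iff hg hr (hP1 S).isPar).mpr (hP1 S),
      ((hP1 S).bal_iff hg).mp (by rw [hP2]; exact S.2.2.2)⟩
  refine Nat.card_congr (Equiv.ofBijective f ⟨?_, ?_⟩)
  · intro S S' h
    have h1 : graphOf (P S) = graphOf (P S') := Subtype.ext_iff.mp h
    apply Subtype.ext
    rw [← hP2 S, ← hP2 S']
    funext i
    ext m
    simp only [sfun, mem_dset]
    simp only [← (hP1 S).isPar.descLeaf, ← (hP1 S').isPar.descLeaf, h1]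
  · rintro ⟨G, hT, hdeg, hbal⟩
    obtain ⟨par, hpar, rfl⟩ := exists_par hT r
    have hC := (cub_iff hg hr hpar).mp hdeg
    let S : {S : Fin (g - 2) → Finset ℕ // Function.Injective S ∧
      IsHier g (Finset.univ.image S) ∧ BalancedFam (Finset.univ.image S)} :=
      ⟨sfun g par, hC.sfun_inj hg, hC.hier hg, (hC.bal_iff hg).mpr hbal⟩
    refine ⟨S, Subtype.ext ?_⟩
    have : P S = par := (hP1 S).unique hg hC (hP2 S)
    simp only [f, this]

end Part5

/-- For every integer `g ≥ 3`, the number of balanced trees is `|T_g^b| = (g-2)!`.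
Equivalently, in the labeled model (vertex `v : Fin (2g-2)` carries the label `v + 1`), the
number of trees on `{1, …, 2g-2}` in which the vertices `1, …, g` have degree `1`, the vertices
`g+1, …, 2g-2` have degree `3`, and every internal vertex is balanced (with respect to the
root leaf `g`), equals `(g-2)! ⬝ (g-2)!`. -/
theorem stmt1 (g : ℕ) (hg : 3 ≤ g) :
    Nat.card {F : Finset (Finset ℕ) // IsHier g F ∧ BalancedFam F} = Nat.factorial (g - 2) ∧
    Nat.card {G : SimpleGraph (Fin (2 * g - 2)) // G.IsTree ∧
        (∀ v : Fin (2 * g - 2), (G.neighborSet v).ncard = if (v : ℕ) < g then 1 else 3) ∧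
        (∀ v : Fin (2 * g - 2), g ≤ (v : ℕ) → BalancedAt g G ⟨g - 1, by omega⟩ v)} =
      Nat.factorial (g - 2) * Nat.factorial (g - 2) := by
  exact ⟨hier_count g hg, graph_count g hg _ rfl⟩
end

section
/- Let g ≥ 3 and k ∈ K_g. With the canonical enumeration u_1,…,u_{g−2} of the internal vertices of T_k, the matrix X_{k,T_k} is lower unitriangular: its (i,i) entries are all equal to 1 and its (i,j) entries vanish for j > i. In particular det(X_{k,T_k}) = 1. -/
/-- `K_g`: sequences `k = (k_1, …, k_{g-2})` with `1 ≤ k_i ≤ i`, encoded as functions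
`ℕ → ℕ` vanishing outside `{1, …, g-2}`. -/
def KSet (g : ℕ) : Set (ℕ → ℕ) :=
  {k | (∀ i, 1 ≤ i → i ≤ g - 2 → 1 ≤ k i ∧ k i ≤ i) ∧ (∀ i, i = 0 ∨ g - 2 < i → k i = 0)}

/-- `buildSet k j s` is the descendant-leaf set of the internal vertex `u_j` of the tree
`T_{(k_1, …, k_{j+s})}`: it starts as `{k_j, j+1}` (the vertex created at step `j`) and at each
later step `t = j + s' + 1` the new leaf `t + 1` is adjoined iff `k_t` already lies in the set. -/
def buildSet (k : ℕ → ℕ) (j : ℕ) : ℕ → Finset ℕ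
  | 0 => {k j, j + 1}
  | s + 1 =>
      if k (j + s + 1) ∈ buildSet k j s then insert (j + s + 2) (buildSet k j s)
      else buildSet k j s

/-- The canonical enumeration `u_1, …, u_{g-2}` of the internal vertices of `T_k`, each vertex
being recorded by its descendant-leaf set `S(u_j) ⊆ {1, …, g-1}`. -/
def canonEnum (g : ℕ) (k : ℕ → ℕ) : ℕ → Finset ℕ :=
  fun j => buildSet k j (g - 2 - j)

/-- The matrix `X_{k,T}` of a tree `T ∈ T_g` whose internal vertices are enumerated as
`v 1, …, v (g-2)` (each recorded by its descendant-leaf set): the `(i, j)` entry (`0`-based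
`i, j : Fin (g-2)`, corresponding to the paper's `1`-based indices `i+1, j+1`) is `1` if both
labels `k_{i+1}` and `i+2` belong to `S(v_{j+1})`, and `0` otherwise. -/
def Xmat (g : ℕ) (k : ℕ → ℕ) (v : ℕ → Finset ℕ) :
    Matrix (Fin (g - 2)) (Fin (g - 2)) ℤ :=
  fun i j =>
    if k (i.val + 1) ∈ v (j.val + 1) ∧ (i.val + 2) ∈ v (j.val + 1) then 1 else 0

theorem buildSet_base (k : ℕ → ℕ) (j s : ℕ) :
    k j ∈ buildSet k j s ∧ j + 1 ∈ buildSet k j s := by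
  induction s with
  | zero => simp [buildSet]
  | succ s ih =>
    rw [buildSet]
    split_ifs
    · exact ⟨Finset.mem_insert_of_mem ih.1, Finset.mem_insert_of_mem ih.2⟩
    · exact ih

theorem buildSet_mem (k : ℕ → ℕ) (j s x : ℕ) (hx : x ∈ buildSet k j s) :
    x = k j ∨ j + 1 ≤ x := by
  induction s with
  | zero =>
    simp only [buildSet, Finset.mem_insert, Finset.mem_singleton] at hx
    omega
  | succ s ih =>
    rw [buildSet] at hx
    split_ifs at hx
    · rcases Finset.mem_insert.1 hx with h | h
      · omega
      · exact ih h
    · exact ih hx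

/-- For `g ≥ 3` and `k ∈ K_g`, with the canonical enumeration of the internal vertices of
`T_k`, the matrix `X_{k, T_k}` is lower unitriangular (diagonal entries `1`, entries above the
diagonal `0`); in particular `det (X_{k, T_k}) = 1`. -/
theorem stmt3 (g : ℕ) (hg : 3 ≤ g) (k : ℕ → ℕ) (hk : k ∈ KSet g) :
    (∀ i : Fin (g - 2), Xmat g k (canonEnum g k) i i = 1) ∧
    (∀ i j : Fin (g - 2), i < j → Xmat g k (canonEnum g k) i j = 0) ∧
    (Xmat g k (canonEnum g k)).det = 1 := by
  have hd : ∀ i : Fin (g - 2), Xmat g k (canonEnum g k) i i = 1 := by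
    intro i
    exact if_pos (buildSet_base k (i.val + 1) _)
  have hu : ∀ i j : Fin (g - 2), i < j → Xmat g k (canonEnum g k) i j = 0 := by
    intro i j hij
    refine if_neg ?_
    rintro ⟨h1, h2⟩
    have a := buildSet_mem _ _ _ _ h1
    have b := buildSet_mem _ _ _ _ h2
    have c := (hk.1 (i.val + 1) (by omega) (by omega)).2
    have d : i.val < j.val := hij
    omega
  refine ⟨hd, hu, ?_⟩
  rw [Matrix.det_of_lowerTriangular _ (fun i j h => hu i j h)]
  exact Finset.prod_eq_one (fun i _ => hd i)
end

section
/- Let g ≥ 3 and let k, k' ∈ K_g with k ≠ k'. With the canonical enumeration u_1,…,u_{g−2} of the internal vertices of T_k, one has det(X_{k',T_k}) = 0. -/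
/-- The labels at most `j + 1` in the descendant set of `u_j` are exactly `k_j` and `j + 1`. -/
theorem mem_buildSet_small (k : ℕ → ℕ) (j s x : ℕ) (hx : x ≤ j + 1) :
    x ∈ buildSet k j s ↔ x = k j ∨ x = j + 1 := by
  induction s with
  | zero => simp [buildSet]
  | succ s ih =>
    rw [buildSet]
    split_ifs
    · rw [Finset.mem_insert, ih]
      have : x ≠ j + s + 2 := by omega
      simp [this]
    · exact ih

/-- For `g ≥ 3` and `k, k' ∈ K_g` with `k ≠ k'`, with the canonical enumeration of the internal
vertices of `T_k`, one has `det (X_{k', T_k}) = 0`. -/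
theorem stmt4 (g : ℕ) (hg : 3 ≤ g) (k k' : ℕ → ℕ) (hk : k ∈ KSet g) (hk' : k' ∈ KSet g)
    (hne : k ≠ k') :
    (Xmat g k' (canonEnum g k)).det = 0 := by
  -- the matrix is lower triangular, with diagonal entries `[k_i = k'_i]`
  have htri : (Xmat g k' (canonEnum g k)).BlockTriangular OrderDual.toDual := by
    intro i j hij
    have hij' : i.val < j.val := hij
    have hi := i.isLt
    have h1 := hk'.1 (i.val + 1) (by omega) (by omega)
    unfold Xmat canonEnum
    rw [if_neg]
    rw [mem_buildSet_small _ _ _ _ (by omega), mem_buildSet_small _ _ _ _ (by omega)]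
    omega
  rw [Matrix.det_of_lowerTriangular _ htri]
  obtain ⟨m, hm⟩ := Function.ne_iff.mp hne
  have hm1 : 1 ≤ m ∧ m ≤ g - 2 := by
    by_contra hcon
    exact hm ((hk.2 m (by omega)).trans (hk'.2 m (by omega)).symm)
  obtain ⟨i, rfl⟩ : ∃ i, m = i + 1 := ⟨m - 1, by omega⟩
  refine Finset.prod_eq_zero (Finset.mem_univ (⟨i, by omega⟩ : Fin (g - 2))) ?_
  have h1 := hk'.1 (i + 1) hm1.1 hm1.2
  unfold Xmat canonEnum
  rw [if_neg]
  dsimp only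
  rw [mem_buildSet_small _ _ _ _ (by omega)]
  omega
end

section
/- Let n ≥ 2 and let Y_1, Y_2, Y_3 be n×n integer matrices that coincide in every column except possibly in one column with index s. Suppose there exist an index t ≠ s and pairwise disjoint subsets B_1, B_2, B_3 ⊆ {1,…,n} such that: the t-th column of each Y_l is the 0–1 indicator vector of B_1 ∪ B_2 ∪ B_3; the s-th column of Y_1 is the indicator vector of B_2 ∪ B_3; the s-th column of Y_2 is the indicator vector of B_3 ∪ B_1; and the s-th column of Y_3 is the indicator vector of B_1 ∪ B_2. Then det(Y_1) + det(Y_2) + det(Y_3) = 0. -/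
/-- Let `n ≥ 2` and let `Y₁, Y₂, Y₃` be `n × n` integer matrices that coincide in every column
except possibly in one column with index `s`.  Suppose there are an index `t ≠ s` and pairwise
disjoint subsets `B₁, B₂, B₃` of the index set such that the `t`-th column of each `Yₗ` is the
`0`–`1` indicator vector of `B₁ ∪ B₂ ∪ B₃`, while the `s`-th columns of `Y₁`, `Y₂`, `Y₃` are the
indicator vectors of `B₂ ∪ B₃`, `B₃ ∪ B₁`, `B₁ ∪ B₂` respectively.  Then
`det Y₁ + det Y₂ + det Y₃ = 0`. -/
theorem stmt5 (n : ℕ) (hn : 2 ≤ n) (Y₁ Y₂ Y₃ : Matrix (Fin n) (Fin n) ℤ)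
    (s t : Fin n) (hts : t ≠ s)
    (B₁ B₂ B₃ : Finset (Fin n))
    (h12 : Disjoint B₁ B₂) (h23 : Disjoint B₂ B₃) (h13 : Disjoint B₁ B₃)
    (hcol : ∀ i j, j ≠ s → Y₁ i j = Y₂ i j ∧ Y₁ i j = Y₃ i j)
    (ht1 : ∀ i, Y₁ i t = if i ∈ B₁ ∪ B₂ ∪ B₃ then 1 else 0)
    (ht2 : ∀ i, Y₂ i t = if i ∈ B₁ ∪ B₂ ∪ B₃ then 1 else 0)
    (ht3 : ∀ i, Y₃ i t = if i ∈ B₁ ∪ B₂ ∪ B₃ then 1 else 0)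
    (hs1 : ∀ i, Y₁ i s = if i ∈ B₂ ∪ B₃ then 1 else 0)
    (hs2 : ∀ i, Y₂ i s = if i ∈ B₃ ∪ B₁ then 1 else 0)
    (hs3 : ∀ i, Y₃ i s = if i ∈ B₁ ∪ B₂ then 1 else 0) :
    Y₁.det + Y₂.det + Y₃.det = 0 := by
  have e2 : Y₂ = Y₁.updateCol s (fun i => Y₂ i s) := by
    ext i j
    by_cases h : j = s
    · subst h; simp
    · simp [h, (hcol i j h).1.symm]
  have e3 : Y₃ = Y₁.updateCol s (fun i => Y₃ i s) := by
    ext i j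
    by_cases h : j = s
    · subst h; simp
    · simp [h, (hcol i j h).2.symm]
  have e1 : Y₁ = Y₁.updateCol s (fun i => Y₁ i s) := by
    ext i j
    by_cases h : j = s
    · subst h; simp
    · simp [h]
  have key : (fun i => Y₁ i s) + (fun i => Y₂ i s) + (fun i => Y₃ i s)
      = (2 : ℤ) • (fun i => Y₁ i t) := by
    funext i
    have a : i ∈ _ → i ∉ _ := fun q => Finset.disjoint_left.mp h12 q
    have b : i ∈ _ → i ∉ _ := fun q => Finset.disjoint_left.mp h23 q
    have c : i ∈ _ → i ∉ _ := fun q => Finset.disjoint_left.mp h13 q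
    simp only [Pi.add_apply, Pi.smul_apply, smul_eq_mul, hs1, hs2, hs3, ht1, Finset.mem_union]
    by_cases x : i ∈ B₁ <;> by_cases y : i ∈ B₂ <;> by_cases z : i ∈ B₃ <;>
      first
      | (exfalso; tauto)
      | simp [x, y, z]
  have d : Y₁.det + Y₂.det + Y₃.det = (Y₁.updateCol s (fun i => Y₁ i s)).det
      + (Y₁.updateCol s (fun i => Y₂ i s)).det + (Y₁.updateCol s (fun i => Y₃ i s)).det := by
    rw [← e1, ← e2, ← e3]
  rw [d, ← Matrix.det_updateCol_add, ← Matrix.det_updateCol_add, key, Matrix.det_updateCol_smul]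
  have z : (Y₁.updateCol s (fun i => Y₁ i t)).det = 0 := by
    apply Matrix.det_zero_of_column_eq hts
    intro i
    simp [hts]
  rw [z, mul_zero]
end

section
/- Let g ≥ 3 and let {T_1, T_2, T_3} ⊆ T_g be a cyclic triple. Then there exist enumerations of the internal vertices of T_1, T_2, T_3 such that for every position j except exactly one position s, the descendant-leaf sets of the j-th internal vertices of T_1, T_2 and T_3 coincide; and for any such enumerations and every k ∈ K_g one has det(X_{k,T_1}) + det(X_{k,T_2}) + det(X_{k,T_3}) = 0. -/
/-- An enumeration `v 1, …, v (g-2)` of the internal vertices of the tree encoded by `F`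
(each vertex recorded by its descendant-leaf set): a bijection from positions `{1, …, g-2}`
onto the family `F`. -/
def IsEnum (g : ℕ) (F : Finset (Finset ℕ)) (v : ℕ → Finset ℕ) : Prop :=
  Set.BijOn v (Set.Icc 1 (g - 2)) (↑F : Set (Finset ℕ))

/-- `{T₁, T₂, T₃}` is a cyclic triple: the three pairwise distinct trees are obtained from a
tree `T₀` having one internal vertex `w` of degree `4` (whose three subtrees away from the root
have leaf-label sets `B₁, B₂, B₃`) by splitting `w` into two adjacent degree-`3` vertices in
the three possible ways; in the hierarchy encoding the three trees share the common family `F₀`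
(the descendant-leaf sets of the internal vertices of `T₀`) and contain the one extra set
`B₂ ∪ B₃`, `B₃ ∪ B₁`, `B₁ ∪ B₂` respectively. -/
def CyclicTriple (g : ℕ) (F₁ F₂ F₃ : Finset (Finset ℕ)) : Prop :=
  F₁ ≠ F₂ ∧ F₂ ≠ F₃ ∧ F₁ ≠ F₃ ∧
  IsHier g F₁ ∧ IsHier g F₂ ∧ IsHier g F₃ ∧
  ∃ (F₀ : Finset (Finset ℕ)) (B₁ B₂ B₃ : Finset ℕ),
    B₁.Nonempty ∧ B₂.Nonempty ∧ B₃.Nonempty ∧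
    Disjoint B₁ B₂ ∧ Disjoint B₂ B₃ ∧ Disjoint B₁ B₃ ∧
    B₁ ∪ B₂ ∪ B₃ ∈ F₀ ∧
    B₂ ∪ B₃ ∉ F₀ ∧ B₃ ∪ B₁ ∉ F₀ ∧ B₁ ∪ B₂ ∉ F₀ ∧
    F₁ = insert (B₂ ∪ B₃) F₀ ∧ F₂ = insert (B₃ ∪ B₁) F₀ ∧ F₃ = insert (B₁ ∪ B₂) F₀

/-- A laminar family of sets with at least two elements inside `N` has at most `|N| - 1` members. -/
theorem laminar_card_le (n : ℕ) : ∀ (N : Finset ℕ) (F : Finset (Finset ℕ)), N.card = n →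
    (∀ A ∈ F, A ⊆ N) → (∀ A ∈ F, 2 ≤ A.card) →
    (∀ A ∈ F, ∀ B ∈ F, A ⊆ B ∨ B ⊆ A ∨ Disjoint A B) → F.card ≤ n - 1 := by
  induction n with
  | zero =>
    intro N F hN hsub hc _
    have hF : F = ∅ := by
      apply Finset.eq_empty_of_forall_notMem
      intro A hA
      have h1 := Finset.card_le_card (hsub A hA)
      have h2 := hc A hA
      omega
    simp [hF]
  | succ n ih =>
    intro N F hN hsub hc hlam
    rcases F.eq_empty_or_nonempty with rfl | hne
    · simp
    obtain ⟨A, hA, hmin⟩ := Finset.exists_min_image F Finset.card hne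
    obtain ⟨a, ha, b, hb, hab⟩ := Finset.one_lt_card.1 (hc A hA)
    have key : ∀ B ∈ F.erase A, A ⊂ B ∨ Disjoint A B := by
      intro B hB
      obtain ⟨hBA, hB⟩ := Finset.mem_erase.1 hB
      rcases hlam A hA B hB with h | h | h
      · exact Or.inl (h.ssubset_of_ne (Ne.symm hBA))
      · exact absurd (Finset.eq_of_subset_of_card_le h (hmin B hB)) hBA
      · exact Or.inr h
    have haN : a ∈ N := hsub A hA ha
    have hinj : Set.InjOn (fun B : Finset ℕ => B.erase a) (↑(F.erase A) : Set (Finset ℕ)) := by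
      have aux : ∀ B ∈ F.erase A, ∀ C ∈ F.erase A, B.erase a = C.erase a → a ∈ B → a ∈ C := by
        intro B hB C hC h haB
        have hAB : A ⊂ B := by
          rcases key B hB with h | h
          · exact h
          · exact absurd haB (Finset.disjoint_left.1 h ha)
        have hbC : b ∈ C := by
          have : b ∈ B.erase a := Finset.mem_erase.2 ⟨Ne.symm hab, hAB.1 hb⟩
          rw [h] at this
          exact Finset.mem_of_mem_erase this
        rcases key C hC with h | h
        · exact h.1 ha
        · exact absurd hbC (Finset.disjoint_left.1 h hb)
      intro B hB C hC h
      have h1 := aux B hB C hC h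
      have h2 := aux C hC B hB h.symm
      ext x
      by_cases hx : x = a
      · subst hx; exact ⟨h1, h2⟩
      · have := congrArg (fun D : Finset ℕ => x ∈ D) h
        simpa [hx] using this
    have := ih (N.erase a) ((F.erase A).image (fun B => B.erase a))
      (by rw [Finset.card_erase_of_mem haN]; omega)
      (by
        intro B hB
        obtain ⟨C, hC, rfl⟩ := Finset.mem_image.1 hB
        exact Finset.erase_subset_erase a (hsub C (Finset.mem_of_mem_erase hC)))
      (by
        intro B hB
        obtain ⟨C, hC, rfl⟩ := Finset.mem_image.1 hB
        have h2 := hc C (Finset.mem_of_mem_erase hC)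
        rcases key C hC with h | h
        · have h3 := Finset.card_lt_card h
          have h4 := hc A hA
          have h5 := Finset.pred_card_le_card_erase (s := C) (a := a)
          show 2 ≤ (C.erase a).card
          omega
        · show 2 ≤ (C.erase a).card
          rw [Finset.erase_eq_of_notMem (Finset.disjoint_left.1 h ha)]
          exact h2)
      (by
        intro B hB B' hB'
        obtain ⟨C, hC, rfl⟩ := Finset.mem_image.1 hB
        obtain ⟨C', hC', rfl⟩ := Finset.mem_image.1 hB'
        rcases hlam C (Finset.mem_of_mem_erase hC) C' (Finset.mem_of_mem_erase hC') with h | h | h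
        · exact Or.inl (Finset.erase_subset_erase a h)
        · exact Or.inr (Or.inl (Finset.erase_subset_erase a h))
        · exact Or.inr (Or.inr (h.mono (Finset.erase_subset _ _) (Finset.erase_subset _ _))))
    rw [Finset.card_image_of_injOn hinj, Finset.card_erase_of_mem hA] at this
    have h1 := Finset.card_le_card (hsub A hA)
    have h2 := hc A hA
    omega

/-- A set compatible with all members of a tree hierarchy belongs to it. -/
theorem IsHier.mem_of_compat {g : ℕ} (hg : 3 ≤ g) {F : Finset (Finset ℕ)} (h : IsHier g F)
    {B : Finset ℕ} (hB : B ⊆ Finset.Icc 1 (g - 1)) (hc : 2 ≤ B.card)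
    (hlam : ∀ A ∈ F, A ⊆ B ∨ B ⊆ A ∨ Disjoint A B) : B ∈ F := by
  by_contra hn
  obtain ⟨h1, h2, _, h4, h5⟩ := h
  have := laminar_card_le (g - 1) (Finset.Icc 1 (g - 1)) (insert B F) (by simp)
    (by
      intro A hA
      rcases Finset.mem_insert.1 hA with rfl | hA
      · exact hB
      · exact h1 A hA)
    (by
      intro A hA
      rcases Finset.mem_insert.1 hA with rfl | hA
      · exact hc
      · exact h2 A hA)
    (by
      intro A hA C hC
      rcases Finset.mem_insert.1 hA with rfl | hA1 <;>
        rcases Finset.mem_insert.1 hC with rfl | hC1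
      · exact Or.inl subset_rfl
      · rcases hlam C hC1 with h | h | h
        · exact Or.inr (Or.inl h)
        · exact Or.inl h
        · exact Or.inr (Or.inr h.symm)
      · exact hlam A hA1
      · exact h4 A hA1 C hC1)
  rw [Finset.card_insert_of_notMem hn] at this
  omega

/-- In a cyclic triple, a non-singleton block is the descendant set of a vertex of `T₀`. -/
theorem block_mem {g : ℕ} (hg : 3 ≤ g) {F₀ : Finset (Finset ℕ)} {B₁ B₂ B₃ : Finset ℕ}
    (n2 : B₂.Nonempty) (d12 : Disjoint B₁ B₂) (d23 : Disjoint B₂ B₃) (d13 : Disjoint B₁ B₃)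
    (h1 : IsHier g (insert (B₂ ∪ B₃) F₀)) (h2 : IsHier g (insert (B₃ ∪ B₁) F₀))
    (h3 : IsHier g (insert (B₁ ∪ B₂) F₀)) (hc : 2 ≤ B₁.card) : B₁ ∈ F₀ := by
  have hm : B₁ ∈ insert (B₂ ∪ B₃) F₀ := by
    apply h1.mem_of_compat hg _ hc
    · intro A hA
      rcases Finset.mem_insert.1 hA with rfl | hA
      · exact Or.inr (Or.inr (Finset.disjoint_union_left.2 ⟨d12.symm, d13.symm⟩))
      · rcases h3.2.2.2.1 A (Finset.mem_insert_of_mem hA) _ (Finset.mem_insert_self _ _) with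
          p | p | p
        · rcases h2.2.2.2.1 A (Finset.mem_insert_of_mem hA) _ (Finset.mem_insert_self _ _) with
            q | q | q
          · left
            intro y hy
            have e1 := p hy
            have e2 := q hy
            rw [Finset.mem_union] at e1 e2
            rcases e1 with e1 | e1
            · exact e1
            · rcases e2 with e2 | e2
              · exact absurd e2 (Finset.disjoint_left.1 d23 e1)
              · exact e2
          · exact Or.inr (Or.inl (Finset.subset_union_right.trans q))
          · exact Or.inr (Or.inr (q.mono_right Finset.subset_union_right))
        · exact Or.inr (Or.inl (Finset.subset_union_left.trans p))
        · exact Or.inr (Or.inr (p.mono_right Finset.subset_union_left))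
    · exact Finset.subset_union_left.trans (h3.1 _ (Finset.mem_insert_self _ _))
  rcases Finset.mem_insert.1 hm with e | e
  · obtain ⟨x, hx⟩ := n2
    exact absurd hx (Finset.disjoint_left.1 d12 (e ▸ Finset.mem_union_left _ hx))
  · exact e

/-- The column of `Xmat` attached to a set `A`. -/
def colOf (g : ℕ) (k : ℕ → ℕ) (A : Finset ℕ) : Fin (g - 2) → ℤ :=
  fun i => if k (i.val + 1) ∈ A ∧ (i.val + 2) ∈ A then 1 else 0

theorem colOf_sum (g : ℕ) (k : ℕ → ℕ) {B₁ B₂ B₃ : Finset ℕ} (d12 : Disjoint B₁ B₂)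
    (d23 : Disjoint B₂ B₃) (d13 : Disjoint B₁ B₃) :
    colOf g k (B₂ ∪ B₃) + colOf g k (B₃ ∪ B₁) + colOf g k (B₁ ∪ B₂) =
      colOf g k (B₁ ∪ B₂ ∪ B₃) + colOf g k B₁ + colOf g k B₂ + colOf g k B₃ := by
  funext i
  simp only [colOf, Pi.add_apply, Finset.mem_union]
  generalize k (i.val + 1) = x
  generalize i.val + 2 = y
  have a1 := @Finset.disjoint_left _ B₁ B₂ |>.1 d12
  have a2 := @Finset.disjoint_left _ B₂ B₃ |>.1 d23
  have a3 := @Finset.disjoint_left _ B₁ B₃ |>.1 d13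
  have b1 := @a1 x
  have b2 := @a2 x
  have b3 := @a3 x
  have c1 := @a1 y
  have c2 := @a2 y
  have c3 := @a3 y
  by_cases x1 : x ∈ B₁ <;> by_cases x2 : x ∈ B₂ <;> by_cases x3 : x ∈ B₃ <;>
  by_cases y1 : y ∈ B₁ <;> by_cases y2 : y ∈ B₂ <;> by_cases y3 : y ∈ B₃ <;>
  simp_all

theorem colOf_small (g : ℕ) (k : ℕ → ℕ) (hk : k ∈ KSet g) {B : Finset ℕ} (hB : B.card < 2) :
    colOf g k B = 0 := by
  funext i
  simp only [colOf, Pi.zero_apply, ite_eq_right_iff]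
  rintro ⟨h1, h2⟩
  have h3 := (hk.1 (i.val + 1) (by omega) (by omega)).2
  have := Finset.card_le_one.1 (Nat.lt_succ_iff.1 hB) _ h1 _ h2
  omega

/-- The exceptional position carries the extra set. -/
theorem enum_extra {g : ℕ} {F₀ : Finset (Finset ℕ)} {C D : Finset ℕ} {v w : ℕ → Finset ℕ} {s : ℕ}
    (hD : D ∉ F₀) (hC : C ∉ F₀) (hCD : insert C F₀ ≠ insert D F₀)
    (hv : IsEnum g (insert C F₀) v) (hw : IsEnum g (insert D F₀) w)
    (h : ∀ j ∈ Set.Icc 1 (g - 2), j ≠ s → v j = w j) : s ∈ Set.Icc 1 (g - 2) ∧ v s = C := by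
  have hne : C ≠ D := fun e => hCD (by rw [e])
  obtain ⟨j, hj, hjC⟩ := hv.surjOn (show C ∈ (↑(insert C F₀) : Set (Finset ℕ)) by simp)
  have hjs : j = s := by
    by_contra hn
    have h1 := hw.mapsTo hj
    rw [← h j hj hn, hjC] at h1
    rcases Finset.mem_insert.1 (Finset.mem_coe.1 h1) with e | e
    · exact hne e
    · exact hC e
  subst hjs
  exact ⟨hj, hjC⟩

theorem enum_exists {g : ℕ} (hg : 3 ≤ g) {F₀ : Finset (Finset ℕ)} {u : ℕ → Finset ℕ}
    (hu : Set.BijOn u (Set.Icc 1 (g - 3)) (↑F₀ : Set (Finset ℕ))) {C : Finset ℕ} (hC : C ∉ F₀) :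
    IsEnum g (insert C F₀) (Function.update u (g - 2) C) := by
  have h1 : Set.Icc 1 (g - 2) = insert (g - 2) (Set.Icc 1 (g - 3)) := by
    ext x; simp only [Set.mem_Icc, Set.mem_insert_iff]; omega
  have hn : g - 2 ∉ Set.Icc 1 (g - 3) := by simp only [Set.mem_Icc]; omega
  have h2 : Set.BijOn (Function.update u (g - 2) C) (Set.Icc 1 (g - 3))
      (↑F₀ : Set (Finset ℕ)) := by
    refine hu.congr ?_
    intro x hx
    rw [Function.update_of_ne]
    rintro rfl
    exact hn hx
  unfold IsEnum
  rw [h1, Finset.coe_insert]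
  have h3 := h2.insert (a := g - 2) (by simpa using hC)
  simpa using h3

/-- Let `g ≥ 3` and let `{T₁, T₂, T₃} ⊆ T_g` be a cyclic triple.  Then there exist enumerations
of the internal vertices of `T₁, T₂, T₃` such that for every position `j` except exactly one
position `s` the descendant-leaf sets of the `j`-th internal vertices of `T₁`, `T₂`, `T₃`
coincide; and for any such enumerations and every `k ∈ K_g` one has
`det X_{k,T₁} + det X_{k,T₂} + det X_{k,T₃} = 0`. -/
theorem stmt6 (g : ℕ) (hg : 3 ≤ g) (F₁ F₂ F₃ : Finset (Finset ℕ))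
    (h : CyclicTriple g F₁ F₂ F₃) :
    (∃ (v₁ v₂ v₃ : ℕ → Finset ℕ) (s : ℕ), s ∈ Set.Icc 1 (g - 2) ∧
      IsEnum g F₁ v₁ ∧ IsEnum g F₂ v₂ ∧ IsEnum g F₃ v₃ ∧
      (∀ j ∈ Set.Icc 1 (g - 2), j ≠ s → v₁ j = v₂ j ∧ v₁ j = v₃ j)) ∧
    (∀ (v₁ v₂ v₃ : ℕ → Finset ℕ) (s : ℕ),
      IsEnum g F₁ v₁ → IsEnum g F₂ v₂ → IsEnum g F₃ v₃ →
      (∀ j ∈ Set.Icc 1 (g - 2), j ≠ s → v₁ j = v₂ j ∧ v₁ j = v₃ j) →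
      ∀ k ∈ KSet g,
        (Xmat g k v₁).det + (Xmat g k v₂).det + (Xmat g k v₃).det = 0) := by
  obtain ⟨n12, n23, n13, H1, H2, H3, F₀, B₁, B₂, B₃, ne1, ne2, ne3, d12, d23, d13, hU, m1, m2, m3,
    rfl, rfl, rfl⟩ := h
  constructor
  · have hcard : F₀.card = g - 3 := by
      have := H1.2.2.2.2
      rw [Finset.card_insert_of_notMem m1] at this
      omega
    obtain ⟨u, hu⟩ : ∃ u : ℕ → Finset ℕ,
        Set.BijOn u (Set.Icc 1 (g - 3)) (↑F₀ : Set (Finset ℕ)) := by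
      apply (Set.finite_Icc 1 (g - 3)).exists_bijOn_of_encard_eq
      rw [Set.encard_coe_eq_coe_finsetCard, ← Finset.coe_Icc, Set.encard_coe_eq_coe_finsetCard]
      simp [hcard]
    refine ⟨_, _, _, g - 2, ?_, enum_exists hg hu m1, enum_exists hg hu m2, enum_exists hg hu m3, ?_⟩
    · simp only [Set.mem_Icc]; omega
    · intro j _ hj
      simp [Function.update_of_ne hj]
  · intro v₁ v₂ v₃ s e1 e2 e3 hv k hk
    obtain ⟨hs, s1⟩ := enum_extra m2 m1 n12 e1 e2 (fun j hj hjs => (hv j hj hjs).1)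
    obtain ⟨-, s2⟩ := enum_extra m1 m2 n12.symm e2 e1 (fun j hj hjs => (hv j hj hjs).1.symm)
    obtain ⟨-, s3⟩ := enum_extra m1 m3 n13.symm e3 e1 (fun j hj hjs => (hv j hj hjs).2.symm)
    have hs' := Set.mem_Icc.1 hs
    let t : Fin (g - 2) := ⟨s - 1, by omega⟩
    have ht : t.val + 1 = s := by show s - 1 + 1 = s; omega
    have hupd : ∀ (w : ℕ → Finset ℕ), (∀ j ∈ Set.Icc 1 (g - 2), j ≠ s → v₁ j = w j) →
        Xmat g k w = (Xmat g k v₁).updateCol t (colOf g k (w s)) := by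
      intro w hw
      ext i j
      rw [Matrix.updateCol_apply]
      split_ifs with hj
      · subst hj
        simp only [Xmat, colOf, ht]
      · have hjs : j.val + 1 ≠ s := by
          intro e
          apply hj
          apply Fin.ext
          omega
        simp only [Xmat, hw (j.val + 1) (Set.mem_Icc.2 ⟨by omega, by omega⟩) hjs]
    have hF : ∀ A ∈ F₀, ((Xmat g k v₁).updateCol t (colOf g k A)).det = 0 := by
      intro A hA
      obtain ⟨j, hj, hjA⟩ := e1.surjOn (Finset.mem_coe.2 (Finset.mem_insert_of_mem hA))
      have hjs : j ≠ s := by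
        rintro rfl
        rw [s1] at hjA
        exact m1 (hjA ▸ hA)
      have hj' := Set.mem_Icc.1 hj
      have hne : t ≠ (⟨j - 1, by omega⟩ : Fin (g - 2)) := by
        intro e
        have := congrArg Fin.val e
        simp only at this
        omega
      refine Matrix.det_zero_of_column_eq hne ?_
      intro i
      rw [Matrix.updateCol_self, Matrix.updateCol_ne (Ne.symm hne)]
      have : j - 1 + 1 = j := by omega
      simp only [Xmat, colOf, this, hjA]
    have hB : ∀ B : Finset ℕ, (2 ≤ B.card → B ∈ F₀) →
        ((Xmat g k v₁).updateCol t (colOf g k B)).det = 0 := by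
      intro B h
      by_cases hc : 2 ≤ B.card
      · exact hF B (h hc)
      · rw [colOf_small g k hk (by omega)]
        apply Matrix.det_eq_zero_of_column_eq_zero t
        intro i
        rw [Matrix.updateCol_self]
        rfl
    have b1 := hB B₁ (block_mem hg ne2 d12 d23 d13 H1 H2 H3)
    have b2 := hB B₂ (block_mem hg ne3 d23 d13.symm d12.symm H2 H3 H1)
    have b3 := hB B₃ (block_mem hg ne1 d13.symm d12 d23.symm H3 H1 H2)
    rw [hupd v₂ (fun j hj hjs => (hv j hj hjs).1), hupd v₃ (fun j hj hjs => (hv j hj hjs).2),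
      congrArg Matrix.det (hupd v₁ (fun _ _ _ => rfl)), s1, s2, s3,
      ← Matrix.det_updateCol_add, ← Matrix.det_updateCol_add, colOf_sum g k d12 d23 d13,
      Matrix.det_updateCol_add, Matrix.det_updateCol_add, Matrix.det_updateCol_add,
      hF _ hU, b1, b2, b3]
    simp
end

section
/- Let g ≥ 3, let F be the free abelian group with basis {e_T : T ∈ T_g}, and let R ⊆ F be the subgroup generated by the elements e_{T_1}+e_{T_2}+e_{T_3} over all cyclic triples {T_1,T_2,T_3} ⊆ T_g. Then for every T ∈ T_g the element e_T is congruent modulo R to an integer linear combination of the elements e_{T'} with T' balanced; that is, the images of {e_T : T ∈ T_g^b} generate the quotient group F/R. -/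
/-- The set `T_g`, as a type. -/
abbrev TreeIdx (g : ℕ) := {F : Finset (Finset ℕ) // IsHier g F}

/-- The free abelian group `F` with basis `{e_T : T ∈ T_g}` (as a `ℤ`-module). -/
abbrev FreeMod (g : ℕ) := TreeIdx g →₀ ℤ

/-- The subgroup `R ⊆ F` generated by the elements `e_{T₁} + e_{T₂} + e_{T₃}` over all
cyclic triples `{T₁, T₂, T₃} ⊆ T_g`. -/
noncomputable def cyclicRel (g : ℕ) : Submodule ℤ (FreeMod g) :=
  Submodule.span ℤ
    {x : FreeMod g | ∃ T₁ T₂ T₃ : TreeIdx g, CyclicTriple g T₁.val T₂.val T₃.val ∧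
      x = Finsupp.single T₁ 1 + Finsupp.single T₂ 1 + Finsupp.single T₃ 1}

/-- The weight of a set of labels: small labels are heavy. -/
def wt (g : ℕ) (S : Finset ℕ) : ℕ := ∑ i ∈ S, 2 ^ (g - i)

lemma wt_lt (g l : ℕ) (S : Finset ℕ) (hS : S ⊆ Finset.Icc 1 (g - 1)) (hl : ∀ i ∈ S, l < i) :
    wt g S < 2 ^ (g - l) := by
  unfold wt
  have h : ∑ k ∈ S.image (fun i => g - i), 2 ^ k = ∑ i ∈ S, 2 ^ (g - i) := by
    apply Finset.sum_image
    intro a ha b hb hab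
    have h1 := Finset.mem_Icc.1 (hS ha)
    have h2 := Finset.mem_Icc.1 (hS hb)
    simp only at hab
    omega
  rw [← h]
  apply Nat.geomSum_lt le_rfl
  intro k hk
  obtain ⟨i, hi, rfl⟩ := Finset.mem_image.1 hk
  have h1 := Finset.mem_Icc.1 (hS hi)
  have h2 := hl i hi
  omega

/-- Two sets of labels compare by the smallest label on which they differ. -/
lemma wt_lt_left (g l₁ l₂ : ℕ) (X B : Finset ℕ) (hX : X ⊆ Finset.Icc 1 (g - 1))
    (h1 : l₁ ∈ B) (h2 : l₂ ∈ B) (hlt : l₁ < l₂) (hX2 : ∀ i ∈ X, i = l₁ ∨ l₂ < i) :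
    wt g X < wt g B := by
  have hB : 2 ^ (g - l₁) + 2 ^ (g - l₂) ≤ wt g B := by
    have : ({l₁, l₂} : Finset ℕ) ⊆ B := by
      intro x hx
      simp only [Finset.mem_insert, Finset.mem_singleton] at hx
      rcases hx with rfl | rfl <;> assumption
    have h3 := Finset.sum_le_sum_of_subset (f := fun i => 2 ^ (g - i)) this
    rw [Finset.sum_pair hlt.ne] at h3
    exact h3
  have hE : wt g (X.erase l₁) < 2 ^ (g - l₂) := by
    apply wt_lt
    · exact (Finset.erase_subset _ _).trans hX
    · intro i hi
      have h4 := Finset.mem_erase.1 hi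
      rcases hX2 i h4.2 with h | h
      · exact absurd h h4.1
      · exact h
  have hle : wt g X ≤ 2 ^ (g - l₁) + wt g (X.erase l₁) := by
    unfold wt
    by_cases hm : l₁ ∈ X
    · rw [Finset.add_sum_erase X (fun i => 2 ^ (g - i)) hm]
    · rw [Finset.erase_eq_of_notMem hm]; exact Nat.le_add_left _ _
  omega

lemma wt_lt_right (g l₁ : ℕ) (X B : Finset ℕ) (hX : X ⊆ Finset.Icc 1 (g - 1))
    (h1 : l₁ ∈ B) (hX2 : ∀ i ∈ X, l₁ < i) : wt g X < wt g B := by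
  have h3 := wt_lt g l₁ X hX hX2
  have h4 : 2 ^ (g - l₁) ≤ wt g B :=
    Finset.single_le_sum (f := fun i => 2 ^ (g - i)) (fun _ _ => Nat.zero_le _) h1
  omega

/-- Replacing `B` by a set `X` compatible with all the other members. -/
lemma isHier_replace {g : ℕ} {F : Finset (Finset ℕ)} (hF : IsHier g F) {B X : Finset ℕ}
    (hB : B ∈ F) (hBtop : B ≠ Finset.Icc 1 (g - 1)) (hX : X ⊆ Finset.Icc 1 (g - 1))
    (hX2 : 2 ≤ X.card) (hXF : X ∉ F)
    (hlam : ∀ D ∈ F, D ≠ B → D ⊆ X ∨ X ⊆ D ∨ Disjoint D X) :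
    IsHier g (insert X (F.erase B)) := by
  obtain ⟨h1, h2, h3, h4, h5⟩ := hF
  refine ⟨?_, ?_, ?_, ?_, ?_⟩
  · intro A hA
    rcases Finset.mem_insert.1 hA with rfl | hA
    · exact hX
    · exact h1 A (Finset.mem_of_mem_erase hA)
  · intro A hA
    rcases Finset.mem_insert.1 hA with rfl | hA
    · exact hX2
    · exact h2 A (Finset.mem_of_mem_erase hA)
  · exact Finset.mem_insert_of_mem (Finset.mem_erase.2 ⟨hBtop.symm, h3⟩)
  · intro P hP Q hQ
    rcases Finset.mem_insert.1 hP with rfl | hP' <;> rcases Finset.mem_insert.1 hQ with rfl | hQ'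
    · exact Or.inl subset_rfl
    · obtain ⟨hq1, hq2⟩ := Finset.mem_erase.1 hQ'
      rcases hlam Q hq2 hq1 with h | h | h
      · exact Or.inr (Or.inl h)
      · exact Or.inl h
      · exact Or.inr (Or.inr h.symm)
    · obtain ⟨hp1, hp2⟩ := Finset.mem_erase.1 hP'
      exact hlam P hp2 hp1
    · exact h4 P (Finset.mem_of_mem_erase hP') Q (Finset.mem_of_mem_erase hQ')
  · rw [Finset.card_insert_of_notMem (fun h => hXF (Finset.mem_of_mem_erase h)),
      Finset.card_erase_of_mem hB, ← h5]
    have : 0 < F.card := Finset.card_pos.2 ⟨B, hB⟩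
    omega

lemma sum_replace (g : ℕ) {F : Finset (Finset ℕ)} {B X : Finset ℕ}
    (hB : B ∈ F) (hXF : X ∉ F) (hlt : wt g X < wt g B) :
    ∑ A ∈ insert X (F.erase B), wt g A < ∑ A ∈ F, wt g A := by
  rw [Finset.sum_insert (fun h => hXF (Finset.mem_of_mem_erase h)),
    ← Finset.add_sum_erase F (wt g) hB]
  omega

/-- The rewriting step at an unbalanced tree. -/
lemma exists_step {g : ℕ} {F : Finset (Finset ℕ)} (hF : IsHier g F) (hb : ¬ BalancedFam F) :
    ∃ F₁ F₂, CyclicTriple g F₁ F₂ F ∧ ∑ A ∈ F₁, wt g A < ∑ A ∈ F, wt g A ∧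
      ∑ A ∈ F₂, wt g A < ∑ A ∈ F, wt g A := by
  have hF' := hF
  obtain ⟨hsub, hcard, htop, hlam, -⟩ := hF'
  unfold BalancedFam at hb
  push Not at hb
  obtain ⟨A₀, hA₀, l₁, l₂, hl1, hl2, hlt, hmin, B₀, hB₀, hBA₀, h1B₀, h2B₀⟩ := hb
  -- `B` is the smallest member containing both labels
  obtain ⟨B, hBm, hBmin⟩ := Finset.exists_min_image
    (F.filter (fun D => l₁ ∈ D ∧ l₂ ∈ D)) Finset.card ⟨B₀, by simp [hB₀, h1B₀, h2B₀]⟩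
  obtain ⟨hB, h1B, h2B⟩ := Finset.mem_filter.1 hBm
  have hBsub : ∀ D ∈ F, l₁ ∈ D → l₂ ∈ D → B ⊆ D := by
    intro D hD h1 h2
    rcases hlam B hB D hD with h | h | h
    · exact h
    · exact (Finset.eq_of_subset_of_card_le h (hBmin D (by simp [hD, h1, h2]))).symm.subset
    · exact absurd h1 (Finset.disjoint_left.1 h h1B)
  have hBA0 : B ⊂ A₀ := lt_of_le_of_lt (hBsub B₀ hB₀ h1B₀ h2B₀) hBA₀
  -- `A` is its parent
  obtain ⟨A, hAm, hAmin⟩ := Finset.exists_min_image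
    (F.filter (fun D => B ⊂ D)) Finset.card ⟨A₀, by simp [hA₀, hBA0]⟩
  obtain ⟨hA, hBA⟩ := Finset.mem_filter.1 hAm
  have hAsub : ∀ D ∈ F, B ⊂ D → A ⊆ D := by
    intro D hD h1
    rcases hlam A hA D hD with h | h | h
    · exact h
    · exact (Finset.eq_of_subset_of_card_le h (hAmin D (by simp [hD, h1]))).symm.subset
    · exact absurd (h1.subset h1B) (Finset.disjoint_left.1 h (hBA.subset h1B))
  have hAA₀ : A ⊆ A₀ := hAsub A₀ hA₀ hBA0
  have hminA : ∀ m ∈ A, m = l₁ ∨ l₂ ≤ m := fun m hm => hmin m (hAA₀ hm)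
  -- the child of `B` containing `l₁`
  obtain ⟨B₁, hB₁B, h1B₁, h2B₁, hB₁D⟩ : ∃ B₁ : Finset ℕ, B₁ ⊆ B ∧ l₁ ∈ B₁ ∧ l₂ ∉ B₁ ∧
      ∀ D ∈ F, D ⊂ B → D ⊆ B₁ ∨ Disjoint D B₁ := by
    refine ⟨B.filter (fun x => x = l₁ ∨ ∃ D ∈ F, D ⊂ B ∧ l₁ ∈ D ∧ x ∈ D),
      Finset.filter_subset _ _, by simp [h1B], ?_, ?_⟩
    · intro h
      rcases (Finset.mem_filter.1 h).2 with h | ⟨D, hD, hDB, h1, h2⟩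
      · omega
      · exact hDB.2 (hBsub D hD h1 h2)
    · intro D hD hDB
      by_cases h : ∃ D' ∈ F, D' ⊂ B ∧ l₁ ∈ D' ∧ D ⊆ D'
      · obtain ⟨D', hD', hDB', h1, h2⟩ := h
        left
        intro x hx
        exact Finset.mem_filter.2 ⟨hDB.1 hx, Or.inr ⟨D', hD', hDB', h1, h2 hx⟩⟩
      · right
        rw [Finset.disjoint_left]
        intro x hx hx'
        rcases (Finset.mem_filter.1 hx').2 with rfl | ⟨D', hD', hDB', h1, h2⟩
        · exact h ⟨D, hD, hDB, hx, subset_rfl⟩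
        · rcases hlam D hD D' hD' with h3 | h3 | h3
          · exact h ⟨D', hD', hDB', h1, h3⟩
          · exact h ⟨D, hD, hDB, h3 h1, subset_rfl⟩
          · exact Finset.disjoint_left.1 h3 hx h2
  -- trichotomy for the other members
  have hcases : ∀ D ∈ F, D ≠ B → D ⊆ B₁ ∨ D ⊆ B \ B₁ ∨ D ⊆ A \ B ∨ A ⊆ D ∨ Disjoint D A := by
    intro D hD hDB
    rcases hlam D hD B hB with h | h | h
    · rcases hB₁D D hD (lt_of_le_of_ne h hDB) with h' | h'
      · exact Or.inl h'
      · exact Or.inr (Or.inl (Finset.subset_sdiff.2 ⟨h, h'⟩))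
    · exact Or.inr (Or.inr (Or.inr (Or.inl (hAsub D hD (lt_of_le_of_ne h hDB.symm)))))
    · rcases hlam D hD A hA with h' | h' | h'
      · exact Or.inr (Or.inr (Or.inl (Finset.subset_sdiff.2 ⟨h', h⟩)))
      · exact Or.inr (Or.inr (Or.inr (Or.inl h')))
      · exact Or.inr (Or.inr (Or.inr (Or.inr h')))
  obtain ⟨c, hcA, hcB⟩ := Finset.exists_of_ssubset hBA
  have hBtop : B ≠ Finset.Icc 1 (g - 1) := by
    rintro rfl
    exact hBA.2 (hsub A hA)
  obtain ⟨B₂, hB₂⟩ : ∃ B₂, B₂ = B \ B₁ := ⟨_, rfl⟩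
  obtain ⟨C, hC⟩ : ∃ C, C = A \ B := ⟨_, rfl⟩
  rw [← hB₂, ← hC] at hcases
  have hcC : c ∈ C := by simp [hC, hcA, hcB]
  have h2B₂ : l₂ ∈ B₂ := by simp [hB₂, h2B, h2B₁]
  have hBu : B₁ ∪ B₂ = B := by rw [hB₂]; exact Finset.union_sdiff_of_subset hB₁B
  have hAu : B ∪ C = A := by rw [hC]; exact Finset.union_sdiff_of_subset hBA.1
  have d12 : Disjoint B₁ B₂ := by rw [hB₂]; exact Finset.disjoint_sdiff
  have dBC : Disjoint B C := by rw [hC]; exact Finset.disjoint_sdiff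
  have hB₂B : B₂ ⊆ B := by rw [hB₂]; exact Finset.sdiff_subset
  have hCA : C ⊆ A := by rw [hC]; exact Finset.sdiff_subset
  have d1C : Disjoint B₁ C := dBC.mono_left hB₁B
  have d2C : Disjoint B₂ C := dBC.mono_left hB₂B
  have hX1A : B₂ ∪ C ⊆ A := Finset.union_subset (hB₂B.trans hBA.1) hCA
  have hX2A : C ∪ B₁ ⊆ A := Finset.union_subset hCA (hB₁B.trans hBA.1)
  have h1B₂ : l₁ ∉ B₂ := Finset.disjoint_left.1 d12 h1B₁
  have h1C : l₁ ∉ C := Finset.disjoint_left.1 dBC h1B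
  have h2C : l₂ ∉ C := Finset.disjoint_left.1 dBC h2B
  have hcB₁ : c ∉ B₁ := fun h => hcB (hB₁B h)
  have hcB₂ : c ∉ B₂ := fun h => hcB (hB₂B h)
  have hX1F : B₂ ∪ C ∉ F := by
    intro h
    rcases hlam _ h B hB with h' | h' | h'
    · exact hcB (h' (Finset.mem_union_right _ hcC))
    · rcases Finset.mem_union.1 (h' h1B) with h | h
      · exact h1B₂ h
      · exact h1C h
    · exact Finset.disjoint_left.1 h' (Finset.mem_union_left _ h2B₂) h2B
  have hX2F : C ∪ B₁ ∉ F := by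
    intro h
    rcases hlam _ h B hB with h' | h' | h'
    · exact hcB (h' (Finset.mem_union_left _ hcC))
    · rcases Finset.mem_union.1 (h' h2B) with h | h
      · exact h2C h
      · exact h2B₁ h
    · exact Finset.disjoint_left.1 h' (Finset.mem_union_right _ h1B₁) h1B
  have hH1 : IsHier g (insert (B₂ ∪ C) (F.erase B)) := by
    refine isHier_replace hF hB hBtop (hX1A.trans (hsub A hA)) ?_ hX1F ?_
    · exact Finset.one_lt_card.2 ⟨l₂, Finset.mem_union_left _ h2B₂, c,
        Finset.mem_union_right _ hcC, fun h => h2C (h ▸ hcC)⟩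
    · intro D hD hDB
      rcases hcases D hD hDB with h | h | h | h | h
      · exact Or.inr (Or.inr (Finset.disjoint_union_right.2 ⟨d12.mono_left h, d1C.mono_left h⟩))
      · exact Or.inl (h.trans Finset.subset_union_left)
      · exact Or.inl (h.trans Finset.subset_union_right)
      · exact Or.inr (Or.inl (hX1A.trans h))
      · exact Or.inr (Or.inr (h.mono_right hX1A))
  have hH2 : IsHier g (insert (C ∪ B₁) (F.erase B)) := by
    refine isHier_replace hF hB hBtop (hX2A.trans (hsub A hA)) ?_ hX2F ?_
    · exact Finset.one_lt_card.2 ⟨l₁, Finset.mem_union_right _ h1B₁, c,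
        Finset.mem_union_left _ hcC, fun h => h1C (h ▸ hcC)⟩
    · intro D hD hDB
      rcases hcases D hD hDB with h | h | h | h | h
      · exact Or.inl (h.trans Finset.subset_union_right)
      · exact Or.inr (Or.inr (Finset.disjoint_union_right.2
          ⟨d2C.mono_left h, d12.symm.mono_left h⟩))
      · exact Or.inl (h.trans Finset.subset_union_left)
      · exact Or.inr (Or.inl (hX2A.trans h))
      · exact Or.inr (Or.inr (h.mono_right hX2A))
  have hX12 : B₂ ∪ C ≠ C ∪ B₁ := by
    intro h
    have h3 : l₁ ∈ B₂ ∪ C := h ▸ Finset.mem_union_right _ h1B₁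
    rcases Finset.mem_union.1 h3 with h | h
    · exact h1B₂ h
    · exact h1C h
  refine ⟨insert (B₂ ∪ C) (F.erase B), insert (C ∪ B₁) (F.erase B),
    ⟨?_, ?_, ?_, hH1, hH2, hF, F.erase B, B₁, B₂, C, ⟨l₁, h1B₁⟩, ⟨l₂, h2B₂⟩, ⟨c, hcC⟩,
      d12, d2C, d1C, ?_, ?_, ?_, ?_, rfl, rfl, ?_⟩, ?_, ?_⟩
  · intro h
    have h3 : B₂ ∪ C ∈ insert (C ∪ B₁) (F.erase B) := h ▸ Finset.mem_insert_self _ _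
    rcases Finset.mem_insert.1 h3 with h | h
    · exact hX12 h
    · exact hX1F (Finset.mem_of_mem_erase h)
  · intro h
    exact hX2F (h ▸ Finset.mem_insert_self _ _)
  · intro h
    exact hX1F (h ▸ Finset.mem_insert_self _ _)
  · rw [hBu, hAu]
    exact Finset.mem_erase.2 ⟨hBA.ne', hA⟩
  · exact fun h => hX1F (Finset.mem_of_mem_erase h)
  · exact fun h => hX2F (Finset.mem_of_mem_erase h)
  · rw [hBu]; exact Finset.notMem_erase _ _
  · rw [hBu, Finset.insert_erase hB]
  · apply sum_replace g hB hX1F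
    apply wt_lt_right g l₁ _ _ (hX1A.trans (hsub A hA)) h1B
    intro i hi
    rcases hminA i (hX1A hi) with rfl | h
    · rcases Finset.mem_union.1 hi with h | h
      · exact absurd h h1B₂
      · exact absurd h h1C
    · omega
  · apply sum_replace g hB hX2F
    apply wt_lt_left g l₁ l₂ _ _ (hX2A.trans (hsub A hA)) h1B h2B hlt
    intro i hi
    rcases hminA i (hX2A hi) with h | h
    · exact Or.inl h
    · right
      refine lt_of_le_of_ne h ?_
      rintro rfl
      rcases Finset.mem_union.1 hi with h | h
      · exact h2C h
      · exact h2B₁ h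

/-- For every `T ∈ T_g`, the element `e_T` is congruent modulo `R` to an integer linear
combination of the elements `e_{T'}` with `T'` balanced; that is, the images of
`{e_T : T ∈ T_g^b}` generate the quotient `F / R`. -/
theorem stmt7 (g : ℕ) (hg : 3 ≤ g) (T : TreeIdx g) :
    (Finsupp.single T 1 : FreeMod g) ∈
      cyclicRel g ⊔ Submodule.span ℤ
        {x : FreeMod g | ∃ T' : TreeIdx g, BalancedFam T'.val ∧ x = Finsupp.single T' 1} := by
  induction hn : (∑ A ∈ T.val, wt g A) using Nat.strong_induction_on generalizing T with
  | _ n ih =>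
    by_cases hb : BalancedFam T.val
    · exact Submodule.mem_sup_right (Submodule.subset_span ⟨T, hb, rfl⟩)
    · obtain ⟨F₁, F₂, hc, hlt1, hlt2⟩ := exists_step T.property hb
      have m1 := ih _ (hn ▸ hlt1) ⟨F₁, hc.2.2.2.1⟩ rfl
      have m2 := ih _ (hn ▸ hlt2) ⟨F₂, hc.2.2.2.2.1⟩ rfl
      have m3 := Submodule.mem_sup_left (T := Submodule.span ℤ
        {x : FreeMod g | ∃ T' : TreeIdx g, BalancedFam T'.val ∧ x = Finsupp.single T' 1})
        (show _ ∈ cyclicRel g from Submodule.subset_span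
          ⟨⟨F₁, hc.2.2.2.1⟩, ⟨F₂, hc.2.2.2.2.1⟩, T, hc, rfl⟩)
      have m4 := Submodule.sub_mem _ m3 (Submodule.add_mem _ m1 m2)
      rwa [add_sub_cancel_left] at m4
end
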